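/- Let [λ,Λ] ⊆ (0,∞), ε ∈ (0,1), and p' ∈ ℝ^{n−1} with |p'| ≤ Λ. Let u ∈ C(closure(B₁∩{xₙ>0})) satisfy, in the viscosity sense in B₁∩{xₙ>0}, both M⁺_{λ,Λ}(D²u) + Λ|Du| + Λu₊ + Λ ≥ 0 and M⁻_{λ,Λ}(D²u) − Λ|Du| − Λu₋ − Λ ≤ 0, and suppose u(x',0) ≥ −(1/(2ε))|x'|² + p'·x' for all (x',0) ∈ B₁∩{xₙ=0}. Then one of the following alternatives holds: (1) for every pₙ ∈ ℝ there exists r ∈ (0,1) such that u(x) ≥ −(1/(2ε))|x'|² + p'·x' + pₙxₙ for all x ∈ B_r∩{xₙ≥0}; or (2) there exists pₙ ∈ ℝ such that for every η > 0 there is r ∈ (0,1) with u(x) − (−(1/(2ε))|x'|² + p'·x' + pₙxₙ) ≥ −ηxₙ for all x ∈ B_r∩{xₙ≥0} and u(x) − (−(1/(2ε))|x'|² + p'·x' + pₙxₙ) ≤ ηxₙ for all x ∈ B_r∩{xₙ > η|x|}. -/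

import Mathlib

open Metric Set Filter Topology Bornology

noncomputable section

abbrev Euc (n : ℕ) := EuclideanSpace ℝ (Fin n)

/-- Hessian matrix of a function at a point (second iterated Fréchet derivative,
a purely local notion). -/
def hessianMatrix {n : ℕ} (φ : Euc n → ℝ) (x : Euc n) : Matrix (Fin n) (Fin n) ℝ :=
  Matrix.of fun i j =>
    iteratedFDeriv ℝ 2 φ x ![EuclideanSpace.single i (1 : ℝ), EuclideanSpace.single j (1 : ℝ)]

/-- The set of symmetric matrices `A` with `λ I ≤ A ≤ Λ I`. -/
def pucciSet (n : ℕ) (l L : ℝ) : Set (Matrix (Fin n) (Fin n) ℝ) :=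
  {A | (A - l • (1 : Matrix (Fin n) (Fin n) ℝ)).PosSemidef ∧
       ((L • (1 : Matrix (Fin n) (Fin n) ℝ)) - A).PosSemidef}

/-- Pucci maximal operator `𝓜⁺_{λ,Λ}`. -/
def pucciPlus {n : ℕ} (l L : ℝ) (M : Matrix (Fin n) (Fin n) ℝ) : ℝ :=
  sSup ((fun A : Matrix (Fin n) (Fin n) ℝ => -(A * M).trace) '' pucciSet n l L)

/-- Pucci minimal operator `𝓜⁻_{λ,Λ}`. -/
def pucciMinus {n : ℕ} (l L : ℝ) (M : Matrix (Fin n) (Fin n) ℝ) : ℝ :=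
  sInf ((fun A : Matrix (Fin n) (Fin n) ℝ => -(A * M).trace) '' pucciSet n l L)

/-- `𝓜⁺_{λ,Λ}(D²u) + Λ|Du| + Λu₊ + Λ ≥ 0` in `V` in the viscosity sense. -/
def ViscPucciSuper {n : ℕ} (l L : ℝ) (V : Set (Euc n)) (u : Euc n → ℝ) : Prop :=
  ∀ x₀ : Euc n, ∀ φ : Euc n → ℝ, ∀ r : ℝ,
    0 < r → ball x₀ r ⊆ V → ContDiffOn ℝ 2 φ (ball x₀ r) →
    (∀ x ∈ ball x₀ r, φ x ≤ u x) → u x₀ = φ x₀ →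
    0 ≤ pucciPlus l L (hessianMatrix φ x₀) + L * ‖gradient φ x₀‖ + L * max (u x₀) 0 + L

/-- `𝓜⁻_{λ,Λ}(D²u) − Λ|Du| − Λu₋ − Λ ≤ 0` in `V` in the viscosity sense. -/
def ViscPucciSub {n : ℕ} (l L : ℝ) (V : Set (Euc n)) (u : Euc n → ℝ) : Prop :=
  ∀ x₀ : Euc n, ∀ φ : Euc n → ℝ, ∀ r : ℝ,
    0 < r → ball x₀ r ⊆ V → ContDiffOn ℝ 2 φ (ball x₀ r) →
    (∀ x ∈ ball x₀ r, u x ≤ φ x) → u x₀ = φ x₀ →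
    pucciMinus l L (hessianMatrix φ x₀) - L * ‖gradient φ x₀‖ - L * max (-(u x₀)) 0 - L ≤ 0

/-- `w` satisfies, in the viscosity sense on `V`, the inequality `β ≤ D α + κ |b| + c` for every
quadratic polynomial with gradient `b` and Hessian `β e ⊗ e - α I` touching `w` from below. -/
def SupSol {E : Type*} [NormedAddCommGroup E] [InnerProductSpace ℝ E]
    (D κ c : ℝ) (V : Set E) (w : E → ℝ) : Prop :=
  ∀ x₀ ∈ V, ∀ (b e : E) (α β : ℝ), 0 ≤ α → 0 ≤ β → ‖e‖ = 1 →
    (∀ᶠ x in 𝓝 x₀, w x₀ + inner ℝ b (x - x₀) + β / 2 * inner ℝ e (x - x₀) ^ 2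
      - α / 2 * ‖x - x₀‖ ^ 2 ≤ w x) →
    β ≤ D * α + κ * ‖b‖ + c

section Basic

variable {E : Type*} [NormedAddCommGroup E] [InnerProductSpace ℝ E]
  {D κ c : ℝ} {V : Set E} {w : E → ℝ}

theorem SupSol.mono (h : SupSol D κ c V w) {κ' c' : ℝ} {V' : Set E} (hκ : κ ≤ κ') (hc : c ≤ c')
    (hV : V' ⊆ V) : SupSol D κ' c' V' w := by
  intro x₀ hx₀ b e α β hα hβ he ht
  have h1 := h x₀ (hV hx₀) b e α β hα hβ he ht
  have h2 : κ * ‖b‖ ≤ κ' * ‖b‖ := mul_le_mul_of_nonneg_right hκ (norm_nonneg b)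
  linarith

theorem SupSol.add_const (h : SupSol D κ c V w) (k : ℝ) : SupSol D κ c V (fun x => w x + k) := by
  intro x₀ hx₀ b e α β hα hβ he ht
  refine h x₀ hx₀ b e α β hα hβ he ?_
  filter_upwards [ht] with x hx
  linarith

theorem SupSol.add_inner (h : SupSol D κ c V w) (hκ : 0 ≤ κ) (p : E) :
    SupSol D κ (c + κ * ‖p‖) V (fun x => w x + inner ℝ p x) := by
  intro x₀ hx₀ b e α β hα hβ he ht
  have h1 := h x₀ hx₀ (b - p) e α β hα hβ he (by
    filter_upwards [ht] with x hx
    rw [inner_sub_left, inner_sub_right p]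
    linarith)
  have h2 : κ * ‖b - p‖ ≤ κ * (‖b‖ + ‖p‖) := mul_le_mul_of_nonneg_left (norm_sub_le b p) hκ
  linarith

theorem SupSol.scale (h : SupSol D κ c V w) {s m : ℝ} (hs : 0 < s) (hm : 0 < m) (z : E) :
    SupSol D (κ * s) (c * s ^ 2 / m) {x | z + s • x ∈ V} (fun x => w (z + s • x) / m) := by
  intro x₀ hx₀ b e α β hα hβ he ht
  have key := h (z + s • x₀) hx₀ ((m / s) • b) e (m / s ^ 2 * α) (m / s ^ 2 * β)
    (by positivity) (by positivity) he (by
      have hT : Tendsto (fun y : E => s⁻¹ • (y - z)) (𝓝 (z + s • x₀)) (𝓝 x₀) := by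
        have : ContinuousAt (fun y : E => s⁻¹ • (y - z)) (z + s • x₀) := by fun_prop
        have h2 := this.tendsto
        simpa [hs.ne', smul_smul] using h2
      filter_upwards [hT.eventually ht] with y hy
      have e1 : z + s • (s⁻¹ • (y - z)) = y := by
        rw [smul_smul, mul_inv_cancel₀ hs.ne', one_smul]; abel
      have e2 : s⁻¹ • (y - z) - x₀ = s⁻¹ • (y - (z + s • x₀)) := by
        rw [← sub_sub, smul_sub s⁻¹ (y - z), smul_smul, inv_mul_cancel₀ hs.ne', one_smul]
      simp only [e1, e2, inner_smul_right, norm_smul, inner_smul_left] at hy ⊢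
      rw [Real.norm_of_nonneg (inv_nonneg.2 hs.le)] at hy
      simp only [conj_trivial] at hy ⊢
      rw [le_div_iff₀ hm] at hy
      refine le_trans (le_of_eq ?_) hy
      field_simp)
  rw [norm_smul, Real.norm_of_nonneg (by positivity)] at key
  have h3 : m / s ^ 2 * β ≤ m / s ^ 2 * (D * α + κ * s * ‖b‖ + c * s ^ 2 / m) := by
    refine key.trans (le_of_eq ?_)
    field_simp
  exact le_of_mul_le_mul_left h3 (by positivity)

/-- If `φ - w` is larger somewhere on `K` than on `K \ U`, then a translate of `φ` touches `w`
from below at some point of `U`. -/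
theorem exists_touching {X : Type*} [TopologicalSpace X] {K U : Set X} (hK : IsCompact K)
    (hU : IsOpen U) (hUK : U ⊆ K) {w φ : X → ℝ} (hw : ContinuousOn w K) (hφ : ContinuousOn φ K)
    {x₁ : X} (hx₁ : x₁ ∈ K) (hlt : ∀ x ∈ K, x ∉ U → φ x - w x < φ x₁ - w x₁) :
    ∃ x₀ ∈ U, ∀ᶠ x in 𝓝 x₀, w x₀ + (φ x - φ x₀) ≤ w x := by
  obtain ⟨x₀, hx₀, hmax⟩ := hK.exists_isMaxOn ⟨x₁, hx₁⟩ (hφ.sub hw)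
  have hmax' : ∀ x ∈ K, φ x - w x ≤ φ x₀ - w x₀ := fun x hx => hmax hx
  have hxU : x₀ ∈ U := by
    by_contra hc
    exact absurd (hmax' x₁ hx₁) (not_le.2 (hlt x₀ hx₀ hc))
  refine ⟨x₀, hxU, ?_⟩
  filter_upwards [hU.mem_nhds hxU] with x hx
  linarith [hmax' x (hUK hx)]

/-- Comparison with a strict classical subsolution. -/
theorem SupSol.comparison (h : SupSol D κ c V w) {K U : Set E} (hK : IsCompact K)
    (hU : IsOpen U) (hUK : U ⊆ K) (hUV : U ⊆ V) {φ : E → ℝ} (hw : ContinuousOn w K)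
    (hφ : ContinuousOn φ K)
    (hsub : ∀ x₀ ∈ U, ∃ (b e : E) (α β : ℝ), 0 ≤ α ∧ 0 ≤ β ∧ ‖e‖ = 1 ∧
      (∀ᶠ x in 𝓝 x₀, φ x₀ + inner ℝ b (x - x₀) + β / 2 * inner ℝ e (x - x₀) ^ 2
        - α / 2 * ‖x - x₀‖ ^ 2 ≤ φ x) ∧ D * α + κ * ‖b‖ + c < β)
    (hle : ∀ x ∈ K, x ∉ U → φ x ≤ w x) : ∀ x ∈ K, φ x ≤ w x := by
  intro x₁ hx₁
  by_contra hc
  push Not at hc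
  obtain ⟨x₀, hx₀, ht⟩ := exists_touching hK hU hUK hw hφ hx₁
    (fun x hx hxU => by linarith [hle x hx hxU])
  obtain ⟨b, e, α, β, hα, hβ, he, hq, hlt⟩ := hsub x₀ hx₀
  have := h x₀ (hUV hx₀) b e α β hα hβ he (by
    filter_upwards [ht, hq] with x h1 h2
    linarith)
  linarith

end Basic

section VertexMap

variable {E : Type*} [NormedAddCommGroup E] [InnerProductSpace ℝ E] [FiniteDimensional ℝ E]
  {D : ℝ} {w : E → ℝ}

/-- Vertices of paraboloids of opening `32` touching a supersolution from below depend in a locally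
Lipschitz way on the contact point. -/
theorem SupSol.vertex_dist_le (hD : 1 ≤ D) (hsol : SupSol D 1 1 (ball 0 1) w)
    (hw : ContinuousOn w (closedBall 0 1)) {x x' y y' : E} (hx : ‖x‖ ≤ 17 / 20)
    (hx' : x' ∈ closedBall (0 : E) 1) (hxy : ‖y - x‖ ≤ 1)
    (hc : ∀ z ∈ closedBall (0 : E) 1, w x + 16 * ‖x - y‖ ^ 2 ≤ w z + 16 * ‖z - y‖ ^ 2)
    (hc' : ∀ z ∈ closedBall (0 : E) 1, w x' + 16 * ‖x' - y'‖ ^ 2 ≤ w z + 16 * ‖z - y'‖ ^ 2)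
    {h : ℝ} (h0 : 0 < h) (h1 : D * h ≤ 1 / 60) (hxx : ‖x - x'‖ ≤ h) :
    ‖y' - y‖ ≤ 24 * D * h := by
  by_contra hcon
  push Not at hcon
  set δ := ‖y' - y‖ with hδ
  have hDh : 0 < D * h := by positivity
  have hδ0 : 0 < δ := by nlinarith
  set e : E := δ⁻¹ • (y' - y) with he
  have he1 : ‖e‖ = 1 := by
    rw [he, norm_smul, norm_inv, Real.norm_of_nonneg hδ0.le, ← hδ, inv_mul_cancel₀ hδ0.ne']
  have hye : y' - y = δ • e := by rw [he, smul_smul, mul_inv_cancel₀ hδ0.ne', one_smul]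
  set k := 32 * δ / (6 * h) with hk
  have hkh : 6 * (k * h) = 32 * δ := by rw [hk]; field_simp
  have hk128 : 128 * D < k := by
    rw [hk, lt_div_iff₀ (by positivity)]; nlinarith
  have hk0 : 0 < k := by linarith
  set m := 7 * k / (64 * D ^ 2) with hm
  have hmD : m * (64 * D ^ 2) = 7 * k := by rw [hm]; field_simp
  have hm0 : 0 < m := by positivity
  set ρ := 8 * (D * h) with hρ
  have hρ0 : 0 < ρ := by positivity
  have hρ1 : ρ ≤ 8 / 60 := by rw [hρ]; linarith
  have hmρ : m * ρ ^ 2 = 7 * k * h ^ 2 := by rw [hρ, ← hmD]; ring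
  -- lower bounds by the two paraboloids
  have low1 : ∀ z ∈ closedBall (0 : E) 1,
      w x + 32 * inner ℝ (y - x) (z - x) - 16 * ‖z - x‖ ^ 2 ≤ w z := by
    intro z hz
    have := hc z hz
    have e1 : ‖z - y‖ ^ 2 = ‖z - x‖ ^ 2 - 2 * inner ℝ (y - x) (z - x) + ‖x - y‖ ^ 2 := by
      have : z - y = (z - x) - (y - x) := by abel
      rw [this, norm_sub_sq_real, real_inner_comm (y - x) (z - x), norm_sub_rev x y]
    rw [e1] at this
    linarith
  have low2 : ∀ z ∈ closedBall (0 : E) 1,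
      w x + 32 * inner ℝ (y - x) (z - x) - 16 * ‖z - x‖ ^ 2
        + 32 * δ * (inner ℝ e (z - x) - h) ≤ w z := by
    intro z hz
    have a1 := hc' z hz
    have a2 := hc x' hx'
    have e1 : ∀ p : E, ‖p - y‖ ^ 2
        = ‖p - x‖ ^ 2 - 2 * inner ℝ (y - x) (p - x) + ‖x - y‖ ^ 2 := by
      intro p
      have : p - y = (p - x) - (y - x) := by abel
      rw [this, norm_sub_sq_real, real_inner_comm (y - x) (p - x), norm_sub_rev x y]
    have e2 : ∀ p : E, ‖p - y'‖ ^ 2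
        = ‖p - y‖ ^ 2 - 2 * δ * inner ℝ e (p - x) + (δ ^ 2 - 2 * δ * inner ℝ e (x - y)) := by
      intro p
      have : p - y' = (p - y) - δ • e := by rw [← hye]; abel
      rw [this, norm_sub_sq_real, inner_smul_right, norm_smul, he1, Real.norm_of_nonneg hδ0.le,
        show p - y = (p - x) + (x - y) by abel, inner_add_left, real_inner_comm e (p - x),
        real_inner_comm e (x - y)]
      ring
    rw [e2 z, e2 x', e1 z] at a1
    have a3 : inner ℝ e (x' - x) ≤ h := by
      refine (real_inner_le_norm _ _).trans ?_
      rw [he1, one_mul, norm_sub_rev]; exact hxx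
    have a4 : δ * inner ℝ e (x' - x) ≤ δ * h := mul_le_mul_of_nonneg_left a3 hδ0.le
    nlinarith
  set φ : E → ℝ := fun z => w x + 32 * inner ℝ (y - x) (z - x) - 16 * ‖z - x‖ ^ 2
    + k * inner ℝ e (z - x) * (inner ℝ e (z - x) + h) - m * ‖z - x‖ ^ 2 with hφ
  have hKsub : closedBall x ρ ⊆ ball (0 : E) 1 := by
    intro z hz
    rw [mem_closedBall, dist_eq_norm] at hz
    rw [mem_ball_zero_iff]
    calc ‖z‖ = ‖(z - x) + x‖ := by rw [sub_add_cancel]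
      _ ≤ ‖z - x‖ + ‖x‖ := norm_add_le _ _
      _ < 1 := by linarith
  have hKsub' : closedBall x ρ ⊆ closedBall (0 : E) 1 := hKsub.trans ball_subset_closedBall
  have hin : Continuous fun z : E => (inner ℝ e (z - x) : ℝ) := by fun_prop
  have hK : IsCompact (closedBall x ρ ∩ {z | -h ≤ inner ℝ e (z - x) ∧ inner ℝ e (z - x) ≤ 2 * h}) :=
    (isCompact_closedBall x ρ).inter_right
      ((isClosed_Icc (a := -h) (b := 2 * h)).preimage hin)
  have hU : IsOpen (ball x ρ ∩ {z | -h < inner ℝ e (z - x) ∧ inner ℝ e (z - x) < 2 * h}) :=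
    isOpen_ball.inter
      ((isOpen_Ioo (a := -h) (b := 2 * h)).preimage hin)
  obtain ⟨z₀, ⟨hz₀, hs₁, hs₂⟩, ht⟩ := exists_touching hK hU
    (fun z hz => ⟨ball_subset_closedBall hz.1, hz.2.1.le, hz.2.2.le⟩)
    (hw.mono (inter_subset_left.trans hKsub')) (φ := φ)
    (by rw [hφ]; fun_prop) (x₁ := x)
    ⟨mem_closedBall_self hρ0.le, by simp [h0.le]⟩ (by
      rintro z ⟨hz, hsl, hsr⟩ hzU
      have b1 := low1 z (hKsub' hz)
      have b2 := low2 z (hKsub' hz)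
      have ex : φ x = w x := by simp [hφ]
      rw [ex, sub_self, sub_neg]
      have hzn : ‖z - x‖ ≤ ρ := by rwa [mem_closedBall, dist_eq_norm] at hz
      have hcs : |inner ℝ e (z - x)| ≤ ‖z - x‖ := by
        simpa [he1] using abs_real_inner_le_norm e (z - x)
      simp only [hφ]
      set s : ℝ := inner ℝ e (z - x) with hs
      rcases eq_or_lt_of_le hsl with hs1 | hs1
      · have : 0 < ‖z - x‖ := lt_of_lt_of_le (by rw [← hs1, abs_neg, abs_of_pos h0]; exact h0) hcs
        have : 0 < m * ‖z - x‖ ^ 2 := by positivity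
        rw [← hs1, neg_add_cancel, mul_zero]
        rw [← hs1] at b2
        linarith
      rcases eq_or_lt_of_le hsr with hs2 | hs2
      · have : 0 < ‖z - x‖ := lt_of_lt_of_le (by rw [hs2, abs_of_pos (by linarith)]; linarith) hcs
        have : 0 < m * ‖z - x‖ ^ 2 := by positivity
        have e5 : k * (2 * h) * (2 * h + h) = 32 * δ * h := by linear_combination h * hkh
        rw [hs2] at b2 ⊢
        linarith
      · have hzρ : ‖z - x‖ = ρ := by
          refine le_antisymm hzn (not_lt.1 fun hlt => hzU ⟨?_, hs1, hs2⟩)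
          rwa [mem_ball, dist_eq_norm]
        have e3 : m * ‖z - x‖ ^ 2 = 7 * k * h ^ 2 := by rw [hzρ, hmρ]
        have e4 : k * s * (s + h) ≤ 6 * (k * h ^ 2) := by
          have p1 : 0 ≤ (2 * h - s) * (s + 3 * h) :=
            mul_nonneg (by linarith) (by linarith)
          have p2 : 0 ≤ k * ((2 * h - s) * (s + 3 * h)) := mul_nonneg hk0.le p1
          linarith
        have : 0 < k * h ^ 2 := by positivity
        linarith)
  have hz₀n : ‖z₀ - x‖ ≤ ρ := by
    have := ball_subset_closedBall hz₀
    rwa [mem_closedBall, dist_eq_norm] at this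
  set s₀ : ℝ := inner ℝ e (z₀ - x) with hs₀
  have key := hsol z₀ (hKsub (ball_subset_closedBall hz₀))
    ((32 : ℝ) • (y - x) - (32 : ℝ) • (z₀ - x) + (k * (2 * s₀ + h)) • e - (2 * m) • (z₀ - x)) e
    (32 + 2 * m) (2 * k) (by positivity) (by positivity) he1 (by
      filter_upwards [ht] with z hz
      refine le_trans (le_of_eq ?_) hz
      have ez : z - x = (z - z₀) + (z₀ - x) := by abel
      have en : ‖z - x‖ ^ 2 = ‖z - z₀‖ ^ 2 + 2 * inner ℝ (z₀ - x) (z - z₀) + ‖z₀ - x‖ ^ 2 := by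
        rw [ez, norm_add_sq_real, real_inner_comm (z₀ - x) (z - z₀)]
      simp only [hφ, en]
      rw [ez]
      simp only [inner_add_right, inner_add_left, inner_sub_left, inner_smul_left, conj_trivial,
        ← hs₀] at *
      ring)
  have nb : ‖(32 : ℝ) • (y - x) - (32 : ℝ) • (z₀ - x) + (k * (2 * s₀ + h)) • e
      - (2 * m) • (z₀ - x)‖ ≤ 32 + 32 * ρ + k * (5 * h) + 2 * m * ρ := by
    have n1 : ‖(32 : ℝ) • (y - x)‖ ≤ 32 := by
      rw [norm_smul, Real.norm_of_nonneg (by norm_num)]; linarith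
    have n2 : ‖(32 : ℝ) • (z₀ - x)‖ ≤ 32 * ρ := by
      rw [norm_smul, Real.norm_of_nonneg (by norm_num)]; linarith
    have n3 : ‖(k * (2 * s₀ + h)) • e‖ ≤ k * (5 * h) := by
      rw [norm_smul, he1, mul_one, Real.norm_eq_abs, abs_mul, abs_of_pos hk0]
      exact mul_le_mul_of_nonneg_left (abs_le.2 ⟨by linarith, by linarith⟩) hk0.le
    have n4 : ‖(2 * m) • (z₀ - x)‖ ≤ 2 * m * ρ := by
      rw [norm_smul, Real.norm_of_nonneg (by positivity)]
      exact mul_le_mul_of_nonneg_left hz₀n (by positivity)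
    refine (norm_sub_le _ _).trans (add_le_add ((norm_add_le _ _).trans (add_le_add
      ((norm_sub_le _ _).trans (add_le_add n1 n2)) n3)) n4)
  have hh : h ≤ 1 / 60 := by nlinarith
  have mD : m * D ≤ 7 / 64 * k := by
    have : m * D * (64 * D) = 7 * k := by rw [← hmD]; ring
    have h2 : 0 < m * D := by positivity
    have h3 : m * D * 1 ≤ m * D * D := mul_le_mul_of_nonneg_left hD h2.le
    linarith
  have mρ : m * ρ ≤ 7 / 64 * k * (8 / 60) := by
    have : m * 1 ≤ m * D := mul_le_mul_of_nonneg_left hD hm0.le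
    exact mul_le_mul (by linarith) hρ1 hρ0.le (by positivity)
  have kh : k * h ≤ k * (1 / 60) := mul_le_mul_of_nonneg_left hh hk0.le
  linarith

end VertexMap

section MeasureEstimate

open MeasureTheory MeasureTheory.Measure Module

variable {E : Type*} [NormedAddCommGroup E] [InnerProductSpace ℝ E] [FiniteDimensional ℝ E]
  {D : ℝ} {w : E → ℝ}

/-- The contact points of a supersolution with paraboloids of opening `32` and vertex in a small
ball depend on the vertex in an expanding way. -/
theorem SupSol.exists_contact_map (hD : 1 ≤ D) (hsol : SupSol D 1 1 (ball 0 1) w)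
    (hw : ContinuousOn w (closedBall 0 1)) (h0 : ∀ x ∈ closedBall (0 : E) 1, 0 ≤ w x)
    {x₁ : E} (hx₁ : x₁ ∈ closedBall (0 : E) (1 / 4)) (hwx₁ : w x₁ ≤ 1) :
    ∃ X : E → E, (∀ y ∈ closedBall (0 : E) (1 / 4), X y ∈ ball (0 : E) 1 ∧ w (X y) ≤ 5) ∧
      ∀ y ∈ closedBall (0 : E) (1 / 4), ∀ y' ∈ closedBall (0 : E) (1 / 4),
        dist y y' ≤ 30 * D * dist (X y) (X y') := by
  have hex : ∀ y : E, ∃ x ∈ closedBall (0 : E) 1, ∀ z ∈ closedBall (0 : E) 1,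
      w x + 16 * ‖x - y‖ ^ 2 ≤ w z + 16 * ‖z - y‖ ^ 2 := by
    intro y
    obtain ⟨x, hx, hmin⟩ := (isCompact_closedBall (0 : E) 1).exists_isMinOn
      ⟨0, mem_closedBall_self zero_le_one⟩
      (hw.add (f := w) (g := fun z => 16 * ‖z - y‖ ^ 2) (by fun_prop))
    exact ⟨x, hx, fun z hz => hmin hz⟩
  choose X hX1 hX using hex
  have hx₁' : x₁ ∈ closedBall (0 : E) 1 := closedBall_subset_closedBall (by norm_num) hx₁
  have bd : ∀ y ∈ closedBall (0 : E) (1 / 4), w (X y) ≤ 5 ∧ ‖X y - y‖ ≤ 9 / 16 := by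
    intro y hy
    have a1 := hX y x₁ hx₁'
    have a2 := h0 _ (hX1 y)
    rw [mem_closedBall_zero_iff] at hy hx₁
    have a3 : ‖x₁ - y‖ ≤ 1 / 2 := (norm_sub_le _ _).trans (by linarith)
    have a4 : ‖x₁ - y‖ ^ 2 ≤ (1 / 2) ^ 2 := pow_le_pow_left₀ (norm_nonneg _) a3 2
    have a5 : 0 ≤ ‖X y - y‖ ^ 2 := sq_nonneg _
    refine ⟨by linarith, ?_⟩
    refine abs_le_of_sq_le_sq' (a := ‖X y - y‖) ?_ (by norm_num) |>.2
    linarith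
  have bd2 : ∀ y ∈ closedBall (0 : E) (1 / 4), ‖X y‖ ≤ 17 / 20 := by
    intro y hy
    have a1 := (bd y hy).2
    rw [mem_closedBall_zero_iff] at hy
    calc ‖X y‖ = ‖(X y - y) + y‖ := by rw [sub_add_cancel]
      _ ≤ ‖X y - y‖ + ‖y‖ := norm_add_le _ _
      _ ≤ 17 / 20 := by linarith
  refine ⟨X, fun y hy => ⟨?_, (bd y hy).1⟩, ?_⟩
  · rw [mem_ball_zero_iff]; linarith [bd2 y hy]
  intro y hy y' hy'
  have hD0 : 0 < D := by linarith
  have main : ∀ h : ℝ, 0 < h → D * h ≤ 1 / 60 → dist (X y) (X y') ≤ h →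
      dist y y' ≤ 24 * D * h := by
    intro h hh hDh hd
    rw [dist_comm, dist_eq_norm]
    refine hsol.vertex_dist_le hD hw (bd2 y hy) (hX1 y') ?_ (hX y) (hX y') hh hDh ?_
    · rw [norm_sub_rev]; linarith [(bd y hy).2]
    · rwa [← dist_eq_norm]
  rcases le_or_gt (1 / 60) (D * dist (X y) (X y')) with hbig | hsmall
  · have : dist y y' ≤ 1 / 4 + 1 / 4 := by
      refine (dist_triangle_right y y' 0).trans (add_le_add ?_ ?_) <;> assumption
    linarith
  · rcases eq_or_lt_of_le (dist_nonneg (x := X y) (y := X y')) with hz | hpos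
    · rw [← hz, mul_zero]
      by_contra hc
      push Not at hc
      set δ := dist y y'
      have e1 : D * min (1 / (60 * D)) (δ / (48 * D)) ≤ 1 / 60 := by
        refine (mul_le_mul_of_nonneg_left (min_le_left _ _) hD0.le).trans (le_of_eq ?_)
        field_simp
      have e2 : 24 * D * min (1 / (60 * D)) (δ / (48 * D)) ≤ δ / 2 := by
        refine (mul_le_mul_of_nonneg_left (min_le_right _ _) (by positivity)).trans (le_of_eq ?_)
        field_simp
        norm_num
      have hm : 0 < min (1 / (60 * D)) (δ / (48 * D)) := by positivity
      have := main _ hm e1 (by rw [← hz]; exact hm.le)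
      linarith
    · have := main _ hpos hsmall.le le_rfl
      nlinarith [mul_pos hD0 hpos]

variable [MeasurableSpace E] [BorelSpace E]

theorem SupSol.measure_unit_le (hD : 1 ≤ D) (hsol : SupSol D 1 1 (ball 0 1) w)
    (hw : ContinuousOn w (closedBall 0 1)) (h0 : ∀ x ∈ closedBall (0 : E) 1, 0 ≤ w x)
    {x₁ : E} (hx₁ : x₁ ∈ closedBall (0 : E) (1 / 4)) (hwx₁ : w x₁ ≤ 1) :
    μH[finrank ℝ E] (ball (0 : E) 1) ≤
      ENNReal.ofReal ((120 * D) ^ finrank ℝ E) *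
        μH[finrank ℝ E] (ball (0 : E) 1 ∩ {x | w x ≤ 5}) := by
  obtain ⟨X, hX, hXd⟩ := hsol.exists_contact_map hD hw h0 hx₁ hwx₁
  have hD0 : 0 < D := by linarith
  set Y := closedBall (0 : E) (1 / 4) with hY
  have hinj : InjOn X Y := by
    intro y hy y' hy' hyy
    have := hXd y hy y' hy'
    rw [hyy, dist_self, mul_zero] at this
    exact dist_le_zero.1 this
  have hlip : LipschitzOnWith (Real.toNNReal (30 * D)) (Function.invFunOn X Y) (X '' Y) := by
    refine LipschitzOnWith.of_dist_le_mul ?_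
    rintro _ ⟨y, hy, rfl⟩ _ ⟨y', hy', rfl⟩
    rw [hinj.leftInvOn_invFunOn hy, hinj.leftInvOn_invFunOn hy',
      Real.coe_toNNReal _ (by positivity)]
    exact hXd y hy y' hy'
  have h1 := hlip.hausdorffMeasure_image_le (d := finrank ℝ E) (Nat.cast_nonneg _)
  rw [hinj.leftInvOn_invFunOn.image_image] at h1
  have h2 : μH[finrank ℝ E] (X '' Y) ≤ μH[finrank ℝ E] (ball (0 : E) 1 ∩ {x | w x ≤ 5}) := by
    refine measure_mono ?_
    rintro _ ⟨y, hy, rfl⟩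
    exact hX y hy
  have h3 : μH[finrank ℝ E] (ball (0 : E) 1) ≤ ENNReal.ofReal (4 ^ finrank ℝ E) *
      μH[finrank ℝ E] Y := by
    rw [hY, ← addHaar_closedBall_mul _ (0 : E) (by norm_num : (0 : ℝ) ≤ 4) (by norm_num)]
    refine measure_mono (ball_subset_closedBall.trans (closedBall_subset_closedBall (by norm_num)))
  calc _ ≤ _ := h3
    _ ≤ _ := mul_le_mul_right (h1.trans (mul_le_mul_right h2 _)) _
    _ = _ := by
      rw [← mul_assoc]
      congr 1
      rw [ENNReal.rpow_natCast, ← ENNReal.ofReal.eq_1, ← ENNReal.ofReal_pow (by positivity),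
        ← ENNReal.ofReal_mul (by positivity), ← mul_pow]
      congr 2
      ring

/-- A nonnegative supersolution that is at most `m` somewhere in the concentric ball of radius
`s / 4` is at most `5 m` on a definite fraction of the ball of radius `s`. -/
theorem SupSol.measure_ball_le (hD : 1 ≤ D) {z : E} {s m : ℝ} (hs : 0 < s) (hs1 : s ≤ 1)
    (hm : 1 ≤ m) (hsol : SupSol D 1 1 (ball z s) w)
    (hw : ContinuousOn w (closedBall z s)) (h0 : ∀ x ∈ closedBall z s, 0 ≤ w x)
    {x₁ : E} (hx₁ : x₁ ∈ closedBall z (s / 4)) (hwx₁ : w x₁ ≤ m) :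
    μH[finrank ℝ E] (ball z s) ≤
      ENNReal.ofReal ((120 * D) ^ finrank ℝ E) *
        μH[finrank ℝ E] (ball z s ∩ {x | w x ≤ 5 * m}) := by
  have hm0 : 0 < m := by linarith
  have hball : ∀ x : E, x ∈ ball (0 : E) 1 → z + s • x ∈ ball z s := by
    intro x hx
    rw [mem_ball_zero_iff] at hx
    rw [mem_ball, dist_eq_norm, add_sub_cancel_left, norm_smul, Real.norm_of_nonneg hs.le]
    nlinarith
  have hcball : ∀ x : E, x ∈ closedBall (0 : E) 1 → z + s • x ∈ closedBall z s := by
    intro x hx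
    rw [mem_closedBall_zero_iff] at hx
    rw [mem_closedBall, dist_eq_norm, add_sub_cancel_left, norm_smul, Real.norm_of_nonneg hs.le]
    nlinarith
  have hsol' : SupSol D 1 1 (ball 0 1) (fun x => w (z + s • x) / m) :=
    (hsol.scale hs hm0 z).mono (by linarith)
      (by rw [div_le_iff₀ hm0]; nlinarith) (fun x hx => hball x hx)
  have hx₁' : s⁻¹ • (x₁ - z) ∈ closedBall (0 : E) (1 / 4) := by
    rw [mem_closedBall, dist_eq_norm] at hx₁
    rw [mem_closedBall_zero_iff, norm_smul, norm_inv, Real.norm_of_nonneg hs.le,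
      inv_mul_le_iff₀ hs]
    linarith
  have e1 : z + s • (s⁻¹ • (x₁ - z)) = x₁ := by
    rw [smul_smul, mul_inv_cancel₀ hs.ne', one_smul]; abel
  have key := hsol'.measure_unit_le hD
    (ContinuousOn.div_const (hw.comp (by fun_prop) hcball) m)
    (fun x hx => div_nonneg (h0 _ (hcball x hx)) hm0.le) hx₁'
    (by rw [e1, div_le_one hm0]; exact hwx₁)
  have h1 : μH[finrank ℝ E] (ball z s) =
      ENNReal.ofReal (s ^ finrank ℝ E) * μH[finrank ℝ E] (ball (0 : E) 1) := by
    rw [← addHaar_ball_mul_of_pos _ z hs, mul_one]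
  have h2 : ENNReal.ofReal (s ^ finrank ℝ E) *
      μH[finrank ℝ E] (ball (0 : E) 1 ∩ {x | w (z + s • x) / m ≤ 5}) ≤
      μH[finrank ℝ E] (ball z s ∩ {x | w x ≤ 5 * m}) := by
    have := addHaar_smul (μH[finrank ℝ E]) s (ball (0 : E) 1 ∩ {x | w (z + s • x) / m ≤ 5})
    rw [abs_of_nonneg (by positivity)] at this
    rw [← this, ← measure_preimage_add (μH[finrank ℝ E]) (-z)]
    refine measure_mono ?_
    intro p hp
    obtain ⟨x, ⟨hx1, hx2⟩, hx⟩ := hp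
    have hpe : p = z + s • x := by
      have : s • x = -z + p := hx
      rw [this]; abel
    rw [hpe]
    refine ⟨hball x hx1, ?_⟩
    have : w (z + s • x) / m ≤ 5 := hx2
    rwa [div_le_iff₀ hm0] at this
  rw [h1]
  calc _ ≤ _ := mul_le_mul_right key (ENNReal.ofReal (s ^ finrank ℝ E))
    _ = _ := mul_left_comm _ _ _
    _ ≤ _ := mul_le_mul_right h2 _

end MeasureEstimate

section Spreading

variable {E : Type*} [NormedAddCommGroup E] [InnerProductSpace ℝ E]
  {D : ℝ} {w : E → ℝ}

theorem add_smul_mem_closedBall {z x : E} {s r : ℝ} (hs : 0 < s)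
    (hx : x ∈ closedBall (0 : E) r) : z + s • x ∈ closedBall z (s * r) := by
  rw [mem_closedBall_zero_iff] at hx
  rw [mem_closedBall, dist_eq_norm, add_sub_cancel_left, norm_smul, Real.norm_of_nonneg hs.le]
  exact mul_le_mul_of_nonneg_left hx hs.le

theorem add_smul_mem_ball {z x : E} {s r : ℝ} (hs : 0 < s)
    (hx : x ∈ ball (0 : E) r) : z + s • x ∈ ball z (s * r) := by
  rw [mem_ball_zero_iff] at hx
  rw [mem_ball, dist_eq_norm, add_sub_cancel_left, norm_smul, Real.norm_of_nonneg hs.le]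
  exact mul_lt_mul_of_pos_left hx hs

theorem inv_smul_sub_mem_closedBall {z x : E} {s r : ℝ} (hs : 0 < s)
    (hx : x ∈ closedBall z (s * r)) : s⁻¹ • (x - z) ∈ closedBall (0 : E) r := by
  rw [mem_closedBall, dist_eq_norm] at hx
  rwa [mem_closedBall_zero_iff, norm_smul, norm_inv, Real.norm_of_nonneg hs.le, inv_mul_le_iff₀ hs]

theorem add_smul_inv_smul_sub {z x : E} {s : ℝ} (hs : s ≠ 0) : z + s • (s⁻¹ • (x - z)) = x := by
  rw [smul_smul, mul_inv_cancel₀ hs, one_smul]; abel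

theorem SupSol.scale_unit {z : E} {s m : ℝ} (hs : 0 < s) (hs1 : s ≤ 1)
    (hm : 1 ≤ m) (hsol : SupSol D 1 1 (ball z s) w) :
    SupSol D 1 1 (ball 0 1) (fun x => w (z + s • x) / m) :=
  (hsol.scale hs (by linarith) z).mono (by linarith)
    (by rw [div_le_iff₀ (by linarith)]; nlinarith)
    (fun x hx => by simpa using add_smul_mem_ball (z := z) hs hx)

/-- The Gaussian is a classical subsolution: a lower quadratic expansion. -/
theorem gaussian_lower_expansion {γ : ℝ} (hγ : 1 ≤ γ) {x₀ x e : E} (hx₀ : ‖x₀‖ ≤ 1)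
    (he : x₀ = ‖x₀‖ • e) (hx : ‖x - x₀‖ ≤ 1 / (2 * γ)) :
    Real.exp (γ * (1 - ‖x₀‖ ^ 2)) - 1
      + inner ℝ ((-(2 * Real.exp (γ * (1 - ‖x₀‖ ^ 2)) * γ)) • x₀) (x - x₀)
      + (2 * Real.exp (γ * (1 - ‖x₀‖ ^ 2)) * γ ^ 2 * ‖x₀‖ ^ 2) / 2 * inner ℝ e (x - x₀) ^ 2
      - (4 * Real.exp (γ * (1 - ‖x₀‖ ^ 2)) * γ) / 2 * ‖x - x₀‖ ^ 2
      ≤ Real.exp (γ * (1 - ‖x‖ ^ 2)) - 1 := by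
  set G := Real.exp (γ * (1 - ‖x₀‖ ^ 2)) with hG
  have hG0 : 0 < G := Real.exp_pos _
  set h := x - x₀ with hh
  have hxe : x = x₀ + h := by rw [hh]; abel
  have ht : inner ℝ x₀ h = ‖x₀‖ * inner ℝ e h := by
    conv_lhs => rw [he, inner_smul_left]
    simp
  set t : ℝ := inner ℝ x₀ h with htdef
  set n := ‖h‖ with hn
  have hn0 : 0 ≤ n := norm_nonneg _
  have hγ0 : 0 < γ := by linarith
  have hnγ : γ * n ≤ 1 / 2 := by
    have := mul_le_mul_of_nonneg_left hx hγ0.le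
    have e1 : γ * (1 / (2 * γ)) = 1 / 2 := by field_simp
    linarith
  have hn1 : n ≤ 1 / 2 := by nlinarith
  have htn : |t| ≤ n := by
    refine (abs_real_inner_le_norm _ _).trans ?_
    nlinarith
  obtain ⟨ht1, ht2⟩ := abs_le.1 htn
  have hq : ‖x‖ ^ 2 = ‖x₀‖ ^ 2 + (2 * t + n ^ 2) := by
    rw [hxe, norm_add_sq_real]; ring
  have hexp : Real.exp (γ * (1 - ‖x‖ ^ 2)) = G * Real.exp (-(γ * (2 * t + n ^ 2)) / 2) ^ 2 := by
    rw [hG, ← Real.exp_nat_mul, ← Real.exp_add, hq]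
    congr 1
    push_cast
    ring
  have hlow : 1 - γ * (2 * t + n ^ 2) / 2 ≤ Real.exp (-(γ * (2 * t + n ^ 2)) / 2) := by
    have := Real.add_one_le_exp (-(γ * (2 * t + n ^ 2)) / 2)
    linarith
  have hpos : 0 ≤ 1 - γ * (2 * t + n ^ 2) / 2 := by
    have : γ * (2 * t + n ^ 2) ≤ γ * (3 * n) := mul_le_mul_of_nonneg_left (by nlinarith) hγ0.le
    linarith
  have hsq : (1 - γ * (2 * t + n ^ 2) / 2) ^ 2 ≤ Real.exp (-(γ * (2 * t + n ^ 2)) / 2) ^ 2 :=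
    pow_le_pow_left₀ hpos hlow 2
  have h1 : 1 - 2 * γ * t + γ ^ 2 * t ^ 2 - 2 * γ * n ^ 2 ≤ (1 - γ * (2 * t + n ^ 2) / 2) ^ 2 := by
    have a1 : -(γ ^ 2 * n ^ 3) ≤ γ ^ 2 * (t * n ^ 2) := by
      have : 0 ≤ γ ^ 2 * n ^ 2 * (t + n) := by
        have : 0 ≤ t + n := by linarith
        positivity
      nlinarith
    have a2 : γ ^ 2 * n ^ 3 ≤ γ * n ^ 2 / 2 := by
      have : γ * n ^ 2 * (γ * n) ≤ γ * n ^ 2 * (1 / 2) := mul_le_mul_of_nonneg_left hnγ (by positivity)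
      nlinarith
    have a3 : 0 ≤ γ ^ 2 * n ^ 4 := by positivity
    have a4 : 0 ≤ γ * n ^ 2 := by positivity
    nlinarith
  have h2 := mul_le_mul_of_nonneg_left (h1.trans hsq) hG0.le
  rw [hexp, inner_smul_left]
  simp only [conj_trivial]
  rw [← htdef]
  have h3 : (2 * G * γ ^ 2 * ‖x₀‖ ^ 2) / 2 * inner ℝ e h ^ 2 = G * γ ^ 2 * t ^ 2 := by
    rw [ht]; ring
  rw [h3]
  linarith

variable [FiniteDimensional ℝ E]

theorem SupSol.spread_unit (hD : 1 ≤ D) (hsol : SupSol D 1 1 (ball 0 1) w)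
    (hw : ContinuousOn w (closedBall 0 1)) (h0 : ∀ x ∈ closedBall (0 : E) 1, 0 ≤ w x)
    (hin : ∀ x ∈ closedBall (0 : E) (1 / 32), Real.exp (2048 * (D + 1)) ≤ w x) :
    ∀ x ∈ closedBall (0 : E) (1 / 2), 1 ≤ w x := by
  set γ := 2048 * (D + 1) with hγ
  have hγ1 : 4096 ≤ γ := by linarith
  have key := hsol.comparison (isCompact_closedBall (0 : E) 1)
    (U := ball 0 1 \ closedBall 0 (1 / 32)) (isOpen_ball.sdiff isClosed_closedBall)
    (fun x hx => ball_subset_closedBall hx.1) (fun x hx => hx.1)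
    (φ := fun x => Real.exp (γ * (1 - ‖x‖ ^ 2)) - 1) hw (by fun_prop) ?_ ?_
  · intro x hx
    refine le_trans ?_ (key x (closedBall_subset_closedBall (by norm_num) hx))
    rw [mem_closedBall_zero_iff] at hx
    have h1 : ‖x‖ ^ 2 ≤ (1 / 2) ^ 2 := pow_le_pow_left₀ (norm_nonneg _) hx 2
    have h2 := Real.add_one_le_exp (γ * (1 - ‖x‖ ^ 2))
    have h3 : γ * (3 / 4) ≤ γ * (1 - ‖x‖ ^ 2) := mul_le_mul_of_nonneg_left (by linarith) (by linarith)
    linarith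
  · rintro x₀ ⟨hx1, hx2⟩
    rw [mem_ball_zero_iff] at hx1
    rw [mem_closedBall_zero_iff, not_le] at hx2
    have hpos : 0 < ‖x₀‖ := by linarith
    have he : x₀ = ‖x₀‖ • (‖x₀‖⁻¹ • x₀) := by
      rw [smul_smul, mul_inv_cancel₀ hpos.ne', one_smul]
    have hG1 : 1 ≤ Real.exp (γ * (1 - ‖x₀‖ ^ 2)) := by
      refine Real.one_le_exp (mul_nonneg (by linarith) ?_)
      nlinarith
    refine ⟨(-(2 * Real.exp (γ * (1 - ‖x₀‖ ^ 2)) * γ)) • x₀, ‖x₀‖⁻¹ • x₀,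
      4 * Real.exp (γ * (1 - ‖x₀‖ ^ 2)) * γ,
      2 * Real.exp (γ * (1 - ‖x₀‖ ^ 2)) * γ ^ 2 * ‖x₀‖ ^ 2, by positivity, by positivity, ?_, ?_, ?_⟩
    · rw [norm_smul, norm_inv, norm_norm, inv_mul_cancel₀ hpos.ne']
    · filter_upwards [closedBall_mem_nhds x₀ (ε := 1 / (2 * γ)) (by positivity)] with x hx
      rw [mem_closedBall, dist_eq_norm] at hx
      exact gaussian_lower_expansion (by linarith) hx1.le he hx
    · rw [norm_smul, norm_neg, Real.norm_of_nonneg (by positivity)]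
      set G := Real.exp (γ * (1 - ‖x₀‖ ^ 2))
      have hGγ : 1 < G * γ := by nlinarith
      have h1 : 1 / 1024 ≤ ‖x₀‖ ^ 2 := by nlinarith
      have h2 : 2 * (G * γ) * γ * (1 / 1024) ≤ 2 * (G * γ) * γ * ‖x₀‖ ^ 2 :=
        mul_le_mul_of_nonneg_left h1 (by positivity)
      have h3 : 2 * (G * γ) * γ * (1 / 1024) = 4 * (G * γ) * (D + 1) := by
        rw [show 2 * (G * γ) * γ * (1 / 1024) = (G * γ) * (γ * (1 / 512)) by ring]
        rw [show γ * (1 / 512) = 4 * (D + 1) by rw [hγ]; ring]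
        ring
      have h4 : G * γ * ‖x₀‖ ≤ G * γ * 1 := mul_le_mul_of_nonneg_left hx1.le (by positivity)
      nlinarith
  · intro x hx hxU
    by_cases hx2 : x ∈ closedBall (0 : E) (1 / 32)
    · have : Real.exp (γ * (1 - ‖x‖ ^ 2)) ≤ Real.exp γ := by
        refine Real.exp_le_exp.2 ?_
        nlinarith [sq_nonneg ‖x‖]
      linarith [hin x hx2]
    · have hx3 : ‖x‖ = 1 := by
        rw [mem_closedBall_zero_iff] at hx
        refine le_antisymm hx (not_lt.1 fun hlt => hxU ⟨mem_ball_zero_iff.2 hlt, hx2⟩)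
      simp [hx3, h0 x hx]

/-- A nonnegative supersolution that is large on a ball is bounded below on a larger ball. -/
theorem SupSol.spread (hD : 1 ≤ D) {L : ℝ} (hL : Real.exp (2048 * (D + 1)) ≤ L) {z : E} {s m : ℝ}
    (hs : 0 < s) (hs1 : s ≤ 1) (hm : 1 ≤ m) (hsol : SupSol D 1 1 (ball z s) w)
    (hw : ContinuousOn w (closedBall z s)) (h0 : ∀ x ∈ closedBall z s, 0 ≤ w x)
    (hin : ∀ x ∈ closedBall z (s / 32), L * m ≤ w x) :
    ∀ x ∈ closedBall z (s / 2), m ≤ w x := by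
  have hm0 : 0 < m := by linarith
  have hcball : ∀ x : E, x ∈ closedBall (0 : E) 1 → z + s • x ∈ closedBall z s := fun x hx => by
    simpa using add_smul_mem_closedBall (z := z) hs hx
  intro x hx
  have key := (hsol.scale_unit hs hs1 hm).spread_unit hD
    (ContinuousOn.div_const (hw.comp (by fun_prop) hcball) m)
    (fun x hx => div_nonneg (h0 _ (hcball x hx)) hm0.le)
    (fun x hx => by
      have := hin (z + s • x) (by
        rw [div_eq_mul_one_div]; exact add_smul_mem_closedBall hs hx)
      rw [le_div_iff₀ hm0]
      exact (mul_le_mul_of_nonneg_right hL hm0.le).trans this)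
    (s⁻¹ • (x - z)) (inv_smul_sub_mem_closedBall hs (by rwa [← div_eq_mul_one_div]))
  rwa [add_smul_inv_smul_sub hs.ne', one_le_div hm0] at key

theorem SupSol.spread_iterate (hD : 1 ≤ D) {L : ℝ} (hL : Real.exp (2048 * (D + 1)) ≤ L) {z : E}
    {ρ m : ℝ} (hρ : 0 < ρ) (hρ1 : 2 * ρ ≤ 1) (hm : 1 ≤ m)
    (hsol : SupSol D 1 1 (ball z (2 * ρ)) w) (hw : ContinuousOn w (closedBall z (2 * ρ)))
    (h0 : ∀ x ∈ closedBall z (2 * ρ), 0 ≤ w x) (j : ℕ)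
    (hin : ∀ x ∈ closedBall z (ρ / 16 ^ j), L ^ j * m ≤ w x) :
    ∀ x ∈ closedBall z ρ, m ≤ w x := by
  have hL1 : 1 ≤ L := le_trans (Real.one_le_exp (by linarith)) hL
  induction j with
  | zero => simpa using hin
  | succ j ih =>
    refine ih ?_
    have h16 : (1 : ℝ) ≤ 16 ^ j := one_le_pow₀ (by norm_num)
    have hle : 2 * ρ / 16 ^ j ≤ 2 * ρ := div_le_self (by linarith) h16
    have key := SupSol.spread hD hL (z := z) (s := 2 * ρ / 16 ^ j) (m := L ^ j * m) (by positivity)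
      (hle.trans hρ1) (one_le_mul_of_one_le_of_one_le (one_le_pow₀ hL1) hm)
      (hsol.mono le_rfl le_rfl (ball_subset_ball hle))
      (hw.mono (closedBall_subset_closedBall hle))
      (fun x hx => h0 x (closedBall_subset_closedBall hle hx))
      (fun x hx => by
        rw [← mul_assoc, ← pow_succ']
        refine hin x ?_
        convert hx using 2
        rw [pow_succ]; field_simp; norm_num)
    intro x hx
    refine key x ?_
    convert hx using 2
    ring

theorem SupSol.spread_pow (hD : 1 ≤ D) {p : ℕ} (hp : Real.exp (2048 * (D + 1)) ≤ 16 ^ p) {z : E}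
    {ρ r m : ℝ} (hr : 0 < r) (hrρ : r ≤ ρ) (hρ1 : 2 * ρ ≤ 1) (hm : 1 ≤ m)
    (hsol : SupSol D 1 1 (ball z (2 * ρ)) w) (hw : ContinuousOn w (closedBall z (2 * ρ)))
    (h0 : ∀ x ∈ closedBall z (2 * ρ), 0 ≤ w x)
    (hin : ∀ x ∈ closedBall z r, (16 * ρ / r) ^ p * m ≤ w x) :
    ∀ x ∈ closedBall z ρ, m ≤ w x := by
  obtain ⟨n, hn1, hn2⟩ := exists_nat_pow_near ((one_le_div hr).2 hrρ) (by norm_num : (1 : ℝ) < 16)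
  have hρ : 0 < ρ := by linarith
  refine SupSol.spread_iterate hD hp hρ hρ1 hm hsol hw h0 (n + 1) fun x hx => ?_
  have h1 : ρ / 16 ^ (n + 1) ≤ r := by
    rw [div_le_iff₀ (by positivity)]
    rw [div_lt_iff₀ hr] at hn2
    linarith
  refine le_trans ?_ (hin x (closedBall_subset_closedBall h1 hx))
  refine mul_le_mul_of_nonneg_right ?_ (by linarith)
  rw [← pow_mul, mul_comm, pow_mul]
  refine pow_le_pow_left₀ (by positivity) ?_ p
  rw [pow_succ, mul_div_assoc]
  linarith

end Spreading

section MeasureDecay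

open MeasureTheory MeasureTheory.Measure Module

variable {E : Type*} [NormedAddCommGroup E] [InnerProductSpace ℝ E] [FiniteDimensional ℝ E]
  [MeasurableSpace E] [BorelSpace E] {D : ℝ} {w : E → ℝ}

theorem SupSol.measure_small_ball_le (hD : 1 ≤ D) {L : ℝ} (hL : Real.exp (2048 * (D + 1)) ≤ L)
    {z : E} {s m : ℝ} (hs : 0 < s) (hs1 : s ≤ 1) (hm : 1 ≤ m) (hsol : SupSol D 1 1 (ball z s) w)
    (hw : ContinuousOn w (closedBall z s)) (h0 : ∀ x ∈ closedBall z s, 0 ≤ w x)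
    {x₁ : E} (hx₁ : x₁ ∈ closedBall z (s / 2)) (hwx₁ : w x₁ ≤ m) :
    μH[finrank ℝ E] (ball z (s / 8)) ≤
      ENNReal.ofReal ((120 * D) ^ finrank ℝ E) *
        μH[finrank ℝ E] (ball z (s / 8) ∩ {x | w x ≤ 10 * L * m}) := by
  have hL1 : 1 ≤ L := le_trans (Real.one_le_exp (by linarith)) hL
  obtain ⟨x₂, hx₂, hwx₂⟩ : ∃ x ∈ closedBall z (s / 32), w x < L * (2 * m) := by
    by_contra! hc
    have := SupSol.spread hD hL hs hs1 (by linarith : 1 ≤ 2 * m) hsol hw h0 hc x₁ hx₁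
    linarith
  have hle : s / 8 ≤ s := by linarith
  have key := SupSol.measure_ball_le hD (z := z) (s := s / 8) (m := L * (2 * m)) (by linarith)
    (by linarith) (by nlinarith) (hsol.mono le_rfl le_rfl (ball_subset_ball hle))
    (hw.mono (closedBall_subset_closedBall hle))
    (fun x hx => h0 x (closedBall_subset_closedBall hle hx))
    (x₁ := x₂) (by convert hx₂ using 2; ring) hwx₂.le
  rwa [show 5 * (L * (2 * m)) = 10 * L * m by ring] at key

variable [Nontrivial E]

theorem SupSol.measure_superlevel_le (hD : 1 ≤ D) {L : ℝ} (hL : Real.exp (2048 * (D + 1)) ≤ L)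
    (hsol : SupSol D 1 1 (ball (0 : E) 1) w)
    (hw : ContinuousOn w (closedBall 0 1)) (h0 : ∀ x ∈ closedBall (0 : E) 1, 0 ≤ w x)
    {x₁ : E} (hx₁ : x₁ ∈ closedBall (0 : E) (1 / 9)) {t : ℝ} (ht : 1 ≤ t) (hwx₁ : w x₁ ≤ t) :
    μH[finrank ℝ E] (closedBall (0 : E) (1 / 9) ∩ {x | t < w x}) ≤
      ENNReal.ofReal ((600 * D) ^ finrank ℝ E) *
        μH[finrank ℝ E] ((closedBall (0 : E) (1 / 9) ∩ {x | t < w x}) ∩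
          {x | w x ≤ 10 * L * t}) := by
  set B := closedBall (0 : E) (1 / 9) with hB
  set F := B ∩ {x | t < w x} with hF
  set G := {x | w x ≤ 10 * L * t} with hG
  set K := B ∩ {x | w x ≤ t} with hK
  have hB1 : B ⊆ closedBall 0 1 := closedBall_subset_closedBall (by norm_num)
  have hKc : IsClosed K := (hw.mono hB1).preimage_isClosed_of_isClosed isClosed_closedBall isClosed_Iic
  have hKcomp : IsCompact K := (isCompact_closedBall (0 : E) (1 / 9)).of_isClosed_subset hKc
    inter_subset_left
  have hKne : K.Nonempty := ⟨x₁, hx₁, hwx₁⟩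
  set r : E → ℝ := fun x => infDist x K with hr
  set c : E → E := fun x => (1 - r x / (2 / 9)) • x with hc
  have hxB : ∀ x ∈ F, ‖x‖ ≤ 1 / 9 := fun x hx => mem_closedBall_zero_iff.1 hx.1
  have hrpos : ∀ x ∈ F, 0 < r x := fun x hx =>
    (hKc.notMem_iff_infDist_pos hKne).1 fun hxK => by
      have h1 : t < w x := hx.2
      have h2 : w x ≤ t := hxK.2
      linarith
  have hrle : ∀ x ∈ F, r x ≤ 2 / 9 := by
    intro x hx
    have h1 : r x ≤ dist x x₁ := infDist_le_dist_of_mem (show x₁ ∈ K from ⟨hx₁, hwx₁⟩)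
    have h2 := dist_triangle_right x x₁ 0
    have := mem_closedBall.1 hx₁
    have := mem_closedBall.1 hx.1
    linarith
  have hcx : ∀ x ∈ F, dist (c x) x ≤ r x / 2 := by
    intro x hx
    have e1 : c x - x = (-(r x / (2 / 9))) • x := by
      simp only [hc]; rw [sub_smul, one_smul, neg_smul]; abel
    rw [dist_eq_norm, e1, norm_smul, norm_neg, Real.norm_of_nonneg (by have := hrpos x hx; positivity)]
    have := mul_le_mul_of_nonneg_left (hxB x hx) (hrpos x hx).le
    linarith
  have hcn : ∀ x ∈ F, ‖c x‖ ≤ 1 / 9 - r x / 2 := by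
    intro x hx
    have h1 := hrle x hx
    have h2 : 0 ≤ 1 - r x / (2 / 9) := by rw [sub_nonneg, div_le_one (by norm_num)]; exact h1
    simp only [hc]
    rw [norm_smul, Real.norm_of_nonneg h2]
    have := mul_le_mul_of_nonneg_left (hxB x hx) h2
    linarith
  have hsubF : ∀ x ∈ F, ball (c x) (r x / 2) ⊆ F := by
    intro x hx y hy
    have hyB : y ∈ B := by
      rw [hB, mem_closedBall_zero_iff]
      have h1 : ‖y‖ ≤ ‖y - c x‖ + ‖c x‖ := by simpa using norm_add_le (y - c x) (c x)
      rw [mem_ball, dist_eq_norm] at hy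
      linarith [hcn x hx]
    refine ⟨hyB, ?_⟩
    by_contra hcon
    have hyK : y ∈ K := ⟨hyB, show w y ≤ t from not_lt.1 hcon⟩
    have h1 : r x ≤ dist x y := infDist_le_dist_of_mem hyK
    have h2 := dist_triangle y (c x) x
    rw [dist_comm x y] at h1
    have := mem_ball.1 hy
    linarith [hcx x hx]
  have hloc : ∀ x ∈ F, μH[finrank ℝ E] (ball (c x) (r x / 2)) ≤
      ENNReal.ofReal ((120 * D) ^ finrank ℝ E) * μH[finrank ℝ E] (ball (c x) (r x / 2) ∩ G) := by
    intro x hx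
    obtain ⟨p, hpK, hp⟩ := hKcomp.exists_infDist_eq_dist hKne x
    have hr1 := hrpos x hx
    have hr2 := hrle x hx
    have hball : closedBall (c x) (4 * r x) ⊆ closedBall 0 1 := by
      refine closedBall_subset_closedBall' ?_
      rw [dist_zero_right]
      linarith [hcn x hx]
    have hball' : ball (c x) (4 * r x) ⊆ ball 0 1 := by
      refine ball_subset_ball' ?_
      rw [dist_zero_right]
      linarith [hcn x hx]
    have key := SupSol.measure_small_ball_le hD hL (z := c x) (s := 4 * r x) (m := t)
      (by linarith) (by linarith) ht (hsol.mono le_rfl le_rfl hball') (hw.mono hball)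
      (fun y hy => h0 y (hball hy)) (x₁ := p) (by
        rw [mem_closedBall]
        have h1 := dist_triangle p x (c x)
        have h2 := hcx x hx
        rw [dist_comm p x, ← hp, dist_comm x (c x)] at h1
        have : infDist x K = r x := rfl
        linarith) hpK.2
    rwa [show 4 * r x / 8 = r x / 2 by ring] at key
  obtain ⟨u, huF, hud, hucov⟩ := Vitali.exists_disjoint_subfamily_covering_enlargement_closedBall
    F c (fun x => r x / 2) 1 (fun x hx => by have := hrle x hx; linarith) 5 (by norm_num)
  have hudb : u.PairwiseDisjoint fun a => ball (c a) (r a / 2) :=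
    hud.mono fun a => ball_subset_closedBall
  have hucount : u.Countable := hudb.countable_of_isOpen (fun a _ => isOpen_ball)
    fun a ha => nonempty_ball.2 (by have := hrpos a (huF ha); linarith)
  have hcov : F ⊆ ⋃ a ∈ u, closedBall (c a) (5 * (r a / 2)) := by
    intro x hx
    obtain ⟨b, hb, hsub⟩ := hucov x hx
    refine mem_iUnion₂.2 ⟨b, hb, hsub ?_⟩
    rw [mem_closedBall, dist_comm]
    exact hcx x hx
  have hmeas : ∀ a ∈ u, MeasurableSet (ball (c a) (r a / 2) ∩ G) := by
    intro a ha
    have e1 : ball (c a) (r a / 2) ∩ G = ball (c a) (r a / 2) ∩ (B ∩ G) := by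
      rw [← inter_assoc, inter_eq_self_of_subset_left (fun x hx => (hsubF a (huF ha) hx).1)]
    rw [e1]
    exact measurableSet_ball.inter
      ((hw.mono hB1).preimage_isClosed_of_isClosed isClosed_closedBall isClosed_Iic).measurableSet
  calc μH[finrank ℝ E] F ≤ μH[finrank ℝ E] (⋃ a ∈ u, closedBall (c a) (5 * (r a / 2))) :=
        measure_mono hcov
    _ ≤ ∑' a : u, μH[finrank ℝ E] (closedBall (c a) (5 * (r a / 2))) :=
        measure_biUnion_le _ hucount _
    _ ≤ ∑' a : u, ENNReal.ofReal ((600 * D) ^ finrank ℝ E) *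
          μH[finrank ℝ E] (ball (c a) (r a / 2) ∩ G) := by
        refine ENNReal.tsum_le_tsum fun a => ?_
        have ha := huF a.2
        have hra := hrpos a ha
        have e1 : μH[finrank ℝ E] (closedBall (c a) (5 * (r a / 2))) =
            ENNReal.ofReal (5 ^ finrank ℝ E) * μH[finrank ℝ E] (ball (c a) (r a / 2)) := by
          rw [addHaar_closedBall_mul _ _ (by norm_num : (0 : ℝ) ≤ 5) (by positivity),
            addHaar_closedBall _ _ (by positivity), addHaar_ball _ (c a) (by positivity)]
        rw [e1, show (600 * D) ^ finrank ℝ E = 5 ^ finrank ℝ E * (120 * D) ^ finrank ℝ E by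
          rw [← mul_pow]; ring_nf, ENNReal.ofReal_mul (by positivity), mul_assoc]
        exact mul_le_mul_right (hloc a ha) _
    _ = ENNReal.ofReal ((600 * D) ^ finrank ℝ E) *
          μH[finrank ℝ E] (⋃ a ∈ u, (ball (c a) (r a / 2) ∩ G)) := by
        rw [ENNReal.tsum_mul_left, measure_biUnion hucount
          (hudb.mono fun a => inter_subset_left) hmeas]
    _ ≤ _ := by
        refine mul_le_mul_right (measure_mono ?_) _
        exact iUnion₂_subset fun a ha => inter_subset_inter_left _ (hsubF a (huF ha))

/-- Measure decay: a supersolution that is small somewhere is bounded by a universal constant on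
most of a ball. -/
theorem SupSol.exists_measure_superlevel_lt (E : Type*) [NormedAddCommGroup E]
    [InnerProductSpace ℝ E] [Nontrivial E] [FiniteDimensional ℝ E] [MeasurableSpace E] [BorelSpace E]
    (hD : 1 ≤ D) : ∃ M : ℝ, 1 ≤ M ∧ ∀ w : E → ℝ, SupSol D 1 1 (ball (0 : E) 1) w →
      ContinuousOn w (closedBall 0 1) → (∀ x ∈ closedBall (0 : E) 1, 0 ≤ w x) →
      ∀ x₁ ∈ closedBall (0 : E) (1 / 9), w x₁ ≤ 1 →
      μH[finrank ℝ E].real (closedBall (0 : E) (1 / 9) ∩ {x | M < w x}) <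
        μH[finrank ℝ E].real (closedBall (0 : E) (1 / 9)) / 2 := by
  set L := Real.exp (2048 * (D + 1)) with hL
  have hL1 : 1 ≤ L := Real.one_le_exp (by linarith)
  set C := (600 * D) ^ finrank ℝ E with hC
  have hC1 : 1 ≤ C := one_le_pow₀ (by linarith)
  have hq0 : 0 ≤ 1 - 1 / C := by
    rw [sub_nonneg, div_le_one (by linarith)]; exact hC1
  have hq1 : 1 - 1 / C < 1 := by
    have : 0 < 1 / C := by positivity
    linarith
  obtain ⟨k, hk⟩ := exists_pow_lt_of_lt_one (by norm_num : (0 : ℝ) < 1 / 2) hq1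
  have hM1 : 1 ≤ 10 * L := by linarith
  refine ⟨(10 * L) ^ k, one_le_pow₀ hM1, fun w hsol hw h0 x₁ hx₁ hwx₁ => ?_⟩
  set B := closedBall (0 : E) (1 / 9) with hB
  have hB1 : B ⊆ closedBall 0 1 := closedBall_subset_closedBall (by norm_num)
  have hfin : ∀ S ⊆ B, μH[finrank ℝ E] S ≠ ⊤ := fun S hS =>
    ((measure_mono hS).trans_lt measure_closedBall_lt_top).ne
  have hle : ∀ t, MeasurableSet (B ∩ {x | w x ≤ t}) := fun t =>
    ((hw.mono hB1).preimage_isClosed_of_isClosed isClosed_closedBall isClosed_Iic).measurableSet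
  have hstep : ∀ t, 1 ≤ t → μH[finrank ℝ E].real (B ∩ {x | 10 * L * t < w x}) ≤
      (1 - 1 / C) * μH[finrank ℝ E].real (B ∩ {x | t < w x}) := by
    intro t ht
    have h1 := hsol.measure_superlevel_le hD hL.symm.le hw h0 hx₁ ht (hwx₁.trans ht)
    have h2 : μH[finrank ℝ E].real (B ∩ {x | t < w x}) ≤
        C * μH[finrank ℝ E].real ((B ∩ {x | t < w x}) ∩ {x | w x ≤ 10 * L * t}) := by
      have h3 := ENNReal.toReal_mono (ENNReal.mul_ne_top ENNReal.ofReal_ne_top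
        (hfin _ (inter_subset_left.trans inter_subset_left))) h1
      rwa [ENNReal.toReal_mul, ENNReal.toReal_ofReal (by positivity)] at h3
    have h4 := measureReal_inter_add_sdiff (μ := μH[finrank ℝ E]) (s := B ∩ {x | t < w x})
      (hle (10 * L * t)) (hfin _ inter_subset_left)
    have e1 : (B ∩ {x | t < w x}) ∩ (B ∩ {x | w x ≤ 10 * L * t}) =
        (B ∩ {x | t < w x}) ∩ {x | w x ≤ 10 * L * t} := by
      ext x; simp only [mem_inter_iff]; tauto
    have e2 : (B ∩ {x | t < w x}) \ (B ∩ {x | w x ≤ 10 * L * t}) = B ∩ {x | 10 * L * t < w x} := by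
      ext x
      refine ⟨fun h => ⟨h.1.1, show 10 * L * t < w x from not_le.1 fun hc => h.2 ⟨h.1.1, hc⟩⟩,
        fun h => ?_⟩
      have h3 : 10 * L * t < w x := h.2
      exact ⟨⟨h.1, show t < w x by nlinarith⟩, fun hc => not_lt.2 (show w x ≤ 10 * L * t from hc.2) h3⟩
    rw [e1, e2] at h4
    set a := μH[finrank ℝ E].real (B ∩ {x | t < w x})
    have h5 : a / C ≤ μH[finrank ℝ E].real ((B ∩ {x | t < w x}) ∩ {x | w x ≤ 10 * L * t}) := by
      rw [div_le_iff₀ (by linarith)]; linarith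
    have : (1 - 1 / C) * a = a - a / C := by ring
    linarith
  have hiter : ∀ j : ℕ, μH[finrank ℝ E].real (B ∩ {x | (10 * L) ^ j < w x}) ≤
      (1 - 1 / C) ^ j * μH[finrank ℝ E].real B := by
    intro j
    induction j with
    | zero => simpa using measureReal_mono inter_subset_left (hfin B le_rfl)
    | succ j ih =>
      rw [pow_succ', pow_succ', mul_assoc (1 - 1 / C)]
      exact (hstep _ (one_le_pow₀ hM1)).trans (mul_le_mul_of_nonneg_left ih hq0)
  have hBpos : 0 < μH[finrank ℝ E].real B :=
    ENNReal.toReal_pos (measure_closedBall_pos _ _ (by norm_num)).ne' (hfin B le_rfl)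
  refine (hiter k).trans_lt ?_
  have := mul_lt_mul_of_pos_right hk hBpos
  linarith

end MeasureDecay

section Harnack

variable {E : Type*} [NormedAddCommGroup E] [InnerProductSpace ℝ E] [FiniteDimensional ℝ E]
  [Nontrivial E] {D : ℝ}

open MeasureTheory MeasureTheory.Measure Module in
/-- A solution that almost attains its maximum at the centre of a ball is large on a smaller
ball. -/
theorem SupSol.exists_lower_bound_of_le_center (E : Type*) [NormedAddCommGroup E]
    [InnerProductSpace ℝ E] [FiniteDimensional ℝ E] [Nontrivial E] (hD : 1 ≤ D) :
    ∃ θ : ℝ, 0 < θ ∧ θ ≤ 1 ∧ ∀ (w : E → ℝ) (y : E) (s : ℝ), 0 < s → s ≤ 1 →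
      SupSol D 1 1 (ball y s) w → SupSol D 1 1 (ball y s) (fun x => -w x) →
      ContinuousOn w (closedBall y s) → (∀ x ∈ closedBall y s, 0 ≤ w x) →
      2 ≤ θ * w y → (∀ x ∈ closedBall y s, w x ≤ (1 + θ) * w y) →
      ∀ x ∈ closedBall y (s / 9), θ * w y / 2 ≤ w x := by
  borelize E
  obtain ⟨M, hM1, hM⟩ := SupSol.exists_measure_superlevel_lt E hD
  refine ⟨1 / (2 * M), by positivity, by rw [div_le_one (by positivity)]; linarith, ?_⟩
  have hMθ : M * (1 / (2 * M)) = 1 / 2 := by field_simp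
  have hθ0 : 0 < 1 / (2 * M) := by positivity
  generalize 1 / (2 * M) = θ at hMθ hθ0 ⊢
  intro w y s hs hs1 hsup hsub hw h0 hθ hle x₁ hx₁
  obtain ⟨A, hA⟩ : ∃ A, A = w y := ⟨_, rfl⟩
  rw [← hA] at hθ hle ⊢
  have hA0 : 0 < A := by
    by_contra hc
    nlinarith
  by_contra! hc
  have hcball : ∀ x : E, x ∈ closedBall (0 : E) 1 → y + s • x ∈ closedBall y s := fun x hx => by
    simpa using add_smul_mem_closedBall (z := y) hs hx
  have hwc : ContinuousOn (fun x => w (y + s • x)) (closedBall (0 : E) 1) :=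
    hw.comp (by fun_prop) hcball
  have hA1 : 1 ≤ θ * A := by linarith
  have hA2 : 1 ≤ θ * A / 2 := by linarith
  have hS1 := (hsub.add_const ((1 + θ) * A)).scale_unit hs hs1 hA1
  have hS2 := hsup.scale_unit hs hs1 hA2
  have h1 := hM (fun x => (-w (y + s • x) + (1 + θ) * A) / (θ * A)) hS1
    ((hwc.neg.add continuousOn_const).div_const _)
    (fun x hx => div_nonneg (by linarith [hle _ (hcball x hx)]) (by positivity))
    0 (by simp) (by
      rw [div_le_one (by positivity), smul_zero, add_zero, ← hA]
      linarith)
  have h2 := hM (fun x => w (y + s • x) / (θ * A / 2)) hS2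
    (hwc.div_const _) (fun x hx => div_nonneg (h0 _ (hcball x hx)) (by positivity))
    (s⁻¹ • (x₁ - y)) (inv_smul_sub_mem_closedBall hs (by rwa [← div_eq_mul_one_div])) (by
      rw [div_le_one (by positivity), add_smul_inv_smul_sub hs.ne']
      exact hc.le)
  have hfin : μH[finrank ℝ E] (closedBall (0 : E) (1 / 9)) ≠ ⊤ := measure_closedBall_lt_top.ne
  have hcov : closedBall (0 : E) (1 / 9) ⊆
      (closedBall (0 : E) (1 / 9) ∩ {x | M < (-w (y + s • x) + (1 + θ) * A) / (θ * A)}) ∪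
      (closedBall (0 : E) (1 / 9) ∩ {x | M < w (y + s • x) / (θ * A / 2)}) := by
    intro x hx
    by_cases hx2 : w (y + s • x) < A / 2
    · refine Or.inl ⟨hx, ?_⟩
      change M < _
      rw [lt_div_iff₀ (by positivity), ← mul_assoc, hMθ]
      nlinarith
    · refine Or.inr ⟨hx, ?_⟩
      change M < _
      rw [lt_div_iff₀ (by positivity), ← mul_div_assoc, ← mul_assoc, hMθ]
      linarith
  have h3 := (measureReal_mono hcov (measure_union_ne_top
    (ne_top_of_le_ne_top hfin (measure_mono inter_subset_left))
    (ne_top_of_le_ne_top hfin (measure_mono inter_subset_left)))).trans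
    (measureReal_union_le (μ := μH[finrank ℝ E]) _ _)
  linarith

/-- Interior Harnack inequality at unit scale. -/
theorem SupSol.exists_harnack_unit (E : Type*) [NormedAddCommGroup E]
    [InnerProductSpace ℝ E] [FiniteDimensional ℝ E] [Nontrivial E] (hD : 1 ≤ D) :
    ∃ C : ℝ, 1 ≤ C ∧ ∀ w : E → ℝ, SupSol D 1 1 (ball 0 1) w →
      SupSol D 1 1 (ball 0 1) (fun x => -w x) →
      ContinuousOn w (closedBall 0 1) → (∀ x ∈ closedBall (0 : E) 1, 0 ≤ w x) →
      C ≤ w 0 → ∀ x ∈ closedBall (0 : E) (1 / 8), 1 ≤ w x := by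
  obtain ⟨θ, hθ0, hθ1, hstep⟩ := SupSol.exists_lower_bound_of_le_center E hD
  obtain ⟨p, hp⟩ := pow_unbounded_of_one_lt (Real.exp (2048 * (D + 1))) (by norm_num : (1 : ℝ) < 16)
  set σ := θ / (2 * (p + 1)) with hσ
  have hσ0 : 0 < σ := by positivity
  have hpσ : p * σ ≤ θ / 2 := by
    rw [hσ, ← mul_div_assoc, div_le_div_iff₀ (by positivity) (by positivity)]
    nlinarith
  have hσ1 : σ ≤ 1 / 2 := by
    rw [hσ, div_le_div_iff₀ (by positivity) (by positivity)]
    have : (0 : ℝ) ≤ p := by positivity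
    nlinarith
  have hσp : 1 ≤ (1 + θ) * (1 - σ) ^ p := by
    have h1 := one_add_mul_le_pow (a := -σ) (by linarith) p
    rw [← sub_eq_add_neg] at h1
    nlinarith
  have h216 : 1 ≤ 216 / σ := by rw [le_div_iff₀ hσ0]; linarith
  have hC2 : 2 / θ ≤ 2 / θ * (216 / σ) ^ p := le_mul_of_one_le_right (by positivity) (one_le_pow₀ h216)
  have h2θ : 1 ≤ 2 / θ := by rw [le_div_iff₀ hθ0]; linarith
  refine ⟨2 / θ * (216 / σ) ^ p, h2θ.trans hC2, ?_⟩
  intro w hsup hsub hw h0 hC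
  have hsub4 : closedBall (0 : E) (1 / 4) ⊆ closedBall 0 1 := closedBall_subset_closedBall (by norm_num)
  obtain ⟨y, hy, hmax⟩ := (isCompact_closedBall (0 : E) (1 / 4)).exists_isMaxOn
    ⟨0, by simp⟩ (f := fun x => w x * (1 / 4 - ‖x‖) ^ p)
    ((hw.mono hsub4).mul (by fun_prop))
  have hmax' : ∀ x ∈ closedBall (0 : E) (1 / 4),
      w x * (1 / 4 - ‖x‖) ^ p ≤ w y * (1 / 4 - ‖y‖) ^ p := fun x hx => hmax hx
  have hp0 : p ≠ 0 := by
    rintro rfl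
    have : 1 ≤ Real.exp (2048 * (D + 1)) := Real.one_le_exp (by linarith)
    rw [pow_zero] at hp
    linarith
  have hyn := mem_closedBall_zero_iff.1 hy
  set d := 1 / 4 - ‖y‖ with hd
  have hA := hmax' 0 (by simp)
  rw [norm_zero, sub_zero] at hA
  have hw0 : 0 < w 0 := by linarith
  have hd0 : 0 < d := by
    refine lt_of_le_of_ne (by linarith) fun h => ?_
    rw [← h, zero_pow hp0, mul_zero] at hA
    have : 0 < w 0 * (1 / 4) ^ p := by positivity
    linarith
  have hd4 : d ≤ 1 / 4 := by linarith [norm_nonneg y]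
  have hAy : w 0 ≤ w y := by
    have h1 : w y * d ^ p ≤ w y * (1 / 4) ^ p :=
      mul_le_mul_of_nonneg_left (pow_le_pow_left₀ hd0.le hd4 p) (h0 y (hsub4 hy))
    exact le_of_mul_le_mul_right (hA.trans h1) (by positivity)
  have hin : ∀ x ∈ closedBall y (σ * d), x ∈ closedBall (0 : E) (1 / 4) ∧ (1 - σ) * d ≤ 1 / 4 - ‖x‖ := by
    intro x hx
    rw [mem_closedBall, dist_eq_norm] at hx
    have h1 : ‖x‖ ≤ ‖x - y‖ + ‖y‖ := by simpa using norm_add_le (x - y) y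
    have h2 : (1 - σ) * d ≤ 1 / 4 - ‖x‖ := by linarith
    refine ⟨?_, h2⟩
    rw [mem_closedBall_zero_iff]
    have : 0 ≤ (1 - σ) * d := mul_nonneg (by linarith) hd0.le
    linarith
  have hbd : ∀ x ∈ closedBall y (σ * d), w x ≤ (1 + θ) * w y := by
    intro x hx
    obtain ⟨hx1, hx2⟩ := hin x hx
    have hx0 := h0 x (hsub4 hx1)
    have h1 : ((1 - σ) * d) ^ p ≤ (1 / 4 - ‖x‖) ^ p :=
      pow_le_pow_left₀ (mul_nonneg (by linarith) hd0.le) hx2 p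
    have h2 := (mul_le_mul_of_nonneg_left h1 hx0).trans (hmax' x hx1)
    rw [mul_pow, ← mul_assoc] at h2
    have h3 : w x * (1 - σ) ^ p ≤ w y := le_of_mul_le_mul_right h2 (by positivity)
    nlinarith
  have hσd : 0 < σ * d := by positivity
  have hb1 : closedBall y (σ * d) ⊆ closedBall 0 1 := fun x hx => hsub4 (hin x hx).1
  have hb2 : ball y (σ * d) ⊆ ball 0 1 := fun x hx => by
    have := mem_closedBall_zero_iff.1 (hin x (ball_subset_closedBall hx)).1
    rw [mem_ball_zero_iff]; linarith
  have key := hstep w y (σ * d) hσd (by nlinarith) (hsup.mono le_rfl le_rfl hb2)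
    (hsub.mono le_rfl le_rfl hb2) (hw.mono hb1) (fun x hx => h0 x (hb1 hx))
    (by
      have := mul_le_mul_of_nonneg_left (hC2.trans (hC.trans hAy)) hθ0.le
      rwa [mul_div_cancel₀ _ hθ0.ne'] at this) hbd
  have hb3 : closedBall y (2 * (3 / 8)) ⊆ closedBall 0 1 :=
    closedBall_subset_closedBall' (by rw [dist_zero_right]; linarith)
  have hb4 : ball y (2 * (3 / 8)) ⊆ ball 0 1 :=
    ball_subset_ball' (by rw [dist_zero_right]; linarith)
  have fin := SupSol.spread_pow hD hp.le (z := y) (ρ := 3 / 8) (r := σ * d / 9) (m := 1)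
    (by positivity) (by nlinarith) (by norm_num) le_rfl (hsup.mono le_rfl le_rfl hb4) (hw.mono hb3)
    (fun x hx => h0 x (hb3 hx)) (fun x hx => by
      refine le_trans ?_ (key x hx)
      have e1 : 16 * (3 / 8) / (σ * d / 9) = 216 / σ * (1 / 4) / d := by field_simp; norm_num
      rw [mul_one, e1, div_pow, div_le_iff₀ (by positivity), mul_pow]
      have h1 := (mul_le_mul_of_nonneg_right hC (by positivity : (0 : ℝ) ≤ (1 / 4) ^ p)).trans hA
      have h2 := mul_le_mul_of_nonneg_left h1 (by positivity : 0 ≤ θ / 2)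
      refine le_trans (le_of_eq ?_) (h2.trans (le_of_eq ?_))
      · field_simp
      · ring)
  intro x hx
  refine fin x (closedBall_subset_closedBall' ?_ hx)
  rw [dist_zero_left]
  linarith

/-- Interior Harnack inequality at scale `s`. -/
theorem SupSol.exists_harnack (E : Type*) [NormedAddCommGroup E]
    [InnerProductSpace ℝ E] [FiniteDimensional ℝ E] [Nontrivial E] (hD : 1 ≤ D) :
    ∃ C : ℝ, 1 ≤ C ∧ ∀ (w : E → ℝ) (y : E) (κ c s m : ℝ), 0 < s → 0 < m → κ * s ≤ 1 →
      c * s ^ 2 ≤ m → SupSol D κ c (ball y s) w → SupSol D κ c (ball y s) (fun x => -w x) →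
      ContinuousOn w (closedBall y s) → (∀ x ∈ closedBall y s, 0 ≤ w x) →
      C * m ≤ w y → ∀ x ∈ closedBall y (s / 8), m ≤ w x := by
  obtain ⟨C, hC1, hC⟩ := SupSol.exists_harnack_unit E hD
  refine ⟨C, hC1, ?_⟩
  intro w y κ c s m hs hm hκ hc hsup hsub hw h0 hwy x hx
  have hcball : ∀ x : E, x ∈ closedBall (0 : E) 1 → y + s • x ∈ closedBall y s := fun x hx => by
    simpa using add_smul_mem_closedBall (z := y) hs hx
  have hball : ball (0 : E) 1 ⊆ {x | y + s • x ∈ ball y s} := fun x hx => by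
    simpa using add_smul_mem_ball (z := y) hs hx
  have hc' : c * s ^ 2 / m ≤ 1 := by rwa [div_le_one hm]
  have h2 := (hsub.scale hs hm y).mono hκ hc' hball
  simp only [neg_div] at h2
  have key := hC (fun x => w (y + s • x) / m) ((hsup.scale hs hm y).mono hκ hc' hball) h2
    (ContinuousOn.div_const (hw.comp (by fun_prop) hcball) m)
    (fun x hx => div_nonneg (h0 _ (hcball x hx)) hm.le)
    (by rw [le_div_iff₀ hm]; simpa using hwy)
    (s⁻¹ • (x - y)) (inv_smul_sub_mem_closedBall hs (by rwa [← div_eq_mul_one_div]))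
  rwa [add_smul_inv_smul_sub hs.ne', one_le_div hm] at key

end Harnack

section HalfSpace

variable {E : Type*} [NormedAddCommGroup E] [InnerProductSpace ℝ E]
  {D κ c : ℝ} {w : E → ℝ} {ν : E}

/-- Comparison with a quadratic barrier. -/
theorem SupSol.quadratic_comparison {V K U : Set E} (hsol : SupSol D κ c V w) (hκ : 0 ≤ κ)
    (hν : ‖ν‖ = 1) (hK : IsCompact K) (hU : IsOpen U) (hUK : U ⊆ K) (hUV : U ⊆ V)
    (hw : ContinuousOn w K) {x₀ : E} {a α β h ρ : ℝ} (hα : 0 ≤ α) (hβ : 0 ≤ β)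
    (hUh : ∀ z ∈ U, |inner ℝ ν z| ≤ h ∧ ‖z - x₀‖ ≤ ρ)
    (hlt : D * α + κ * (|a| + β * h + α * ρ) + c < β)
    (hle : ∀ x ∈ K, x ∉ U →
      a * inner ℝ ν x + β / 2 * inner ℝ ν x ^ 2 - α / 2 * ‖x - x₀‖ ^ 2 ≤ w x) :
    ∀ x ∈ K, a * inner ℝ ν x + β / 2 * inner ℝ ν x ^ 2 - α / 2 * ‖x - x₀‖ ^ 2 ≤ w x := by
  refine hsol.comparison hK hU hUK hUV hw (by fun_prop) (fun z hz => ?_) hle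
  obtain ⟨h1, h2⟩ := hUh z hz
  refine ⟨(a + β * inner ℝ ν z) • ν - α • (z - x₀), ν, α, β, hα, hβ, hν, ?_, ?_⟩
  · refine Eventually.of_forall fun x => le_of_eq ?_
    have e1 : x - x₀ = (z - x₀) + (x - z) := by abel
    have e2 : inner ℝ ν x = inner ℝ ν z + inner ℝ ν (x - z) := by rw [inner_sub_right]; ring
    rw [e2, e1, norm_add_sq_real, inner_sub_left, inner_smul_left, inner_smul_left]
    simp only [conj_trivial]
    ring
  · have h3 : ‖(a + β * inner ℝ ν z) • ν - α • (z - x₀)‖ ≤ |a| + β * h + α * ρ := by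
      refine (norm_sub_le _ _).trans ?_
      rw [norm_smul, norm_smul, hν, mul_one, Real.norm_eq_abs, Real.norm_of_nonneg hα]
      have h4 := abs_add_le a (β * inner ℝ ν z)
      rw [abs_mul, abs_of_nonneg hβ] at h4
      have h5 := mul_le_mul_of_nonneg_left h1 hβ
      have h6 := mul_le_mul_of_nonneg_left h2 hα
      linarith
    have h7 := mul_le_mul_of_nonneg_left h3 hκ
    linarith

theorem norm_sub_inner_smul_le (hν : ‖ν‖ = 1) (x : E) : ‖x - (inner ℝ ν x : ℝ) • ν‖ ≤ ‖x‖ := by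
  have h1 : ‖x - (inner ℝ ν x : ℝ) • ν‖ ^ 2 ≤ ‖x‖ ^ 2 := by
    rw [norm_sub_sq_real, inner_smul_right, norm_smul, hν, real_inner_comm, Real.norm_eq_abs,
      mul_one, sq_abs]
    nlinarith [sq_nonneg (inner ℝ ν x)]
  exact le_of_sq_le_sq h1 (norm_nonneg x)

theorem inner_sub_inner_smul (hν : ‖ν‖ = 1) (x : E) :
    inner ℝ ν (x - (inner ℝ ν x : ℝ) • ν) = (0 : ℝ) := by
  rw [inner_sub_right, inner_smul_right, real_inner_self_eq_norm_sq, hν]; ring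

theorem abs_inner_le_norm_sub (hν : ‖ν‖ = 1) {x₀ : E} (hx₀ : inner ℝ ν x₀ = (0 : ℝ)) (x : E) :
    |inner ℝ ν x| ≤ ‖x - x₀‖ := by
  have h1 := abs_real_inner_le_norm ν (x - x₀)
  rwa [inner_sub_right, hx₀, sub_zero, hν, one_mul] at h1

theorem isClosed_inner_nonneg (ν : E) : IsClosed {x : E | 0 ≤ inner ℝ ν x} :=
  isClosed_le continuous_const (by fun_prop)

theorem isOpen_inner_pos (ν : E) : IsOpen {x : E | 0 < inner ℝ ν x} :=
  isOpen_lt continuous_const (by fun_prop)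

variable [FiniteDimensional ℝ E]

/-- A supersolution that is nonnegative on the flat boundary is bounded below linearly. -/
theorem SupSol.exists_linear_lower_bound (hD : 0 ≤ D) (hκ : 0 ≤ κ) (hc : 0 ≤ c) (hν : ‖ν‖ = 1)
    {R m : ℝ} (hR : 0 < R) (hm : 0 ≤ m)
    (hsol : SupSol D κ c (ball 0 R ∩ {x | 0 < inner ℝ ν x}) w)
    (hw : ContinuousOn w (closedBall 0 R ∩ {x | 0 ≤ inner ℝ ν x}))
    (h0 : ∀ x ∈ closedBall (0 : E) R, inner ℝ ν x = (0 : ℝ) → 0 ≤ w x)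
    (hlow : ∀ x ∈ closedBall (0 : E) R, 0 ≤ inner ℝ ν x → -m ≤ w x) :
    ∃ p : ℝ, ∃ r > 0, ∀ x ∈ ball (0 : E) r, 0 ≤ inner ℝ ν x → p * inner ℝ ν x ≤ w x := by
  obtain ⟨ρ, hρ0, hρR, hκρ⟩ : ∃ ρ > 0, ρ ≤ R / 2 ∧ κ * ρ ≤ 1 / 4 := by
    refine ⟨min (R / 2) (1 / (4 * (κ + 1))), by positivity, min_le_left _ _, ?_⟩
    refine (mul_le_mul_of_nonneg_left (min_le_right _ _) hκ).trans ?_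
    rw [← mul_div_assoc, div_le_div_iff₀ (by positivity) (by positivity)]
    linarith
  set α := 2 * m / ρ ^ 2 with hα
  have hα0 : 0 ≤ α := by positivity
  have hαρ : α / 2 * ρ ^ 2 = m := by rw [hα]; field_simp
  set β := 4 * (D * α + α + c + 1) with hβ
  have hβ0 : 0 ≤ β := by positivity
  refine ⟨-(β * ρ / 2 + α * ρ), ρ, hρ0, fun x hx hxν => ?_⟩
  rw [mem_ball_zero_iff] at hx
  set t : ℝ := inner ℝ ν x with ht
  set x₀ := x - t • ν with hx₀
  have hx₀ν : inner ℝ ν x₀ = (0 : ℝ) := inner_sub_inner_smul hν x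
  have hx₀n : ‖x₀‖ ≤ ρ := (norm_sub_inner_smul_le hν x).trans hx.le
  have hxx₀ : ‖x - x₀‖ = t := by
    rw [hx₀, sub_sub_cancel, norm_smul, hν, mul_one, Real.norm_of_nonneg hxν]
  have htρ : t ≤ ρ := by
    have := real_inner_le_norm ν x
    rw [hν, one_mul] at this
    linarith
  have hcb : closedBall x₀ ρ ⊆ closedBall 0 R :=
    closedBall_subset_closedBall' (by rw [dist_zero_right]; linarith)
  have hbb : ball x₀ ρ ⊆ ball 0 R :=
    ball_subset_ball' (by rw [dist_zero_right]; linarith)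
  have key := hsol.quadratic_comparison hκ hν
    (K := closedBall x₀ ρ ∩ {x | 0 ≤ inner ℝ ν x}) (U := ball x₀ ρ ∩ {x | 0 < inner ℝ ν x})
    ((isCompact_closedBall _ _).inter_right (isClosed_inner_nonneg ν))
    (isOpen_ball.inter (isOpen_inner_pos ν))
    (fun z hz => ⟨ball_subset_closedBall hz.1, show (0 : ℝ) ≤ inner ℝ ν z from le_of_lt hz.2⟩)
    (inter_subset_inter_left _ hbb) (hw.mono (inter_subset_inter_left _ hcb))
    (x₀ := x₀) (a := -(β * ρ / 2)) (α := α) (β := β) (h := ρ) (ρ := ρ) hα0 hβ0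
    (fun z hz => by
      have h1 : ‖z - x₀‖ ≤ ρ := by rw [← dist_eq_norm]; exact (mem_ball.1 hz.1).le
      exact ⟨(abs_inner_le_norm_sub hν hx₀ν z).trans h1, h1⟩)
    (by
      rw [abs_neg, abs_of_nonneg (by positivity)]
      have h1 := mul_le_mul_of_nonneg_right hκρ hβ0
      have h2 := mul_le_mul_of_nonneg_right hκρ hα0
      nlinarith)
    (fun z hz hzU => by
      have hzν : (0 : ℝ) ≤ inner ℝ ν z := hz.2
      have h1 : ‖z - x₀‖ ≤ ρ := by rw [← dist_eq_norm]; exact mem_closedBall.1 hz.1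
      have h2 := (le_abs_self _).trans ((abs_inner_le_norm_sub hν hx₀ν z).trans h1)
      have h3 : β / 2 * inner ℝ ν z * (inner ℝ ν z - ρ) ≤ 0 :=
        mul_nonpos_of_nonneg_of_nonpos (by positivity) (by linarith)
      rcases hzν.eq_or_lt with hz0 | hzpos
      · rw [← hz0]
        have := h0 z (hcb hz.1) hz0.symm
        have : 0 ≤ α / 2 * ‖z - x₀‖ ^ 2 := by positivity
        linarith
      · have h4 : ‖z - x₀‖ = ρ := by
          refine le_antisymm h1 (not_lt.1 fun hlt => hzU ⟨?_, hzpos⟩)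
          rwa [mem_ball, dist_eq_norm]
        rw [h4, hαρ]
        have := hlow z (hcb hz.1) hzν
        nlinarith)
    x ⟨by rw [mem_closedBall, dist_eq_norm, hxx₀]; exact htρ, hxν⟩
  refine le_trans ?_ key
  rw [hxx₀, ← ht]
  have h5 : 0 ≤ β / 2 * t ^ 2 := by positivity
  have h6 : α * t * t ≤ α * t * ρ := mul_le_mul_of_nonneg_left htρ (by positivity)
  have h7 : 0 ≤ α * t * t := by positivity
  nlinarith

/-- Hopf-type lemma: a nonnegative supersolution that is bounded below on a slab at height `h` grows
linearly from the flat boundary. -/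
theorem SupSol.linear_growth (hD : 1 ≤ D) (hκ : 0 ≤ κ) (hν : ‖ν‖ = 1)
    {ρ h m : ℝ} (hh : 0 < h) (hhρ : 8 * D * h ^ 2 ≤ ρ ^ 2) (hρ : 0 < ρ) (hm : 0 < m)
    (hκh : 10 * κ * h ≤ 1) (hch : 4 * c * h ^ 2 ≤ m)
    (hsol : SupSol D κ c (ball 0 (2 * ρ) ∩ {x | 0 < inner ℝ ν x}) w)
    (hw : ContinuousOn w (closedBall 0 (2 * ρ) ∩ {x | 0 ≤ inner ℝ ν x}))
    (h0 : ∀ x ∈ closedBall (0 : E) (2 * ρ), 0 ≤ inner ℝ ν x → 0 ≤ w x)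
    (hslab : ∀ x ∈ closedBall (0 : E) (2 * ρ), inner ℝ ν x = h → m ≤ w x) :
    ∀ x ∈ ball (0 : E) h, 0 ≤ inner ℝ ν x → m / (2 * h) * inner ℝ ν x ≤ w x := by
  intro x hx hxν
  have hhρ' : 2 * h ≤ ρ := by
    refine le_of_sq_le_sq ?_ hρ.le
    nlinarith [sq_nonneg h]
  rw [mem_ball_zero_iff] at hx
  set t : ℝ := inner ℝ ν x with ht
  set x₀ := x - t • ν with hx₀
  have hx₀ν : inner ℝ ν x₀ = (0 : ℝ) := inner_sub_inner_smul hν x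
  have hx₀n : ‖x₀‖ ≤ h := (norm_sub_inner_smul_le hν x).trans hx.le
  have hxx₀ : ‖x - x₀‖ = t := by
    rw [hx₀, sub_sub_cancel, norm_smul, hν, mul_one, Real.norm_of_nonneg hxν]
  have hth : t ≤ h := by
    have := real_inner_le_norm ν x
    rw [hν, one_mul] at this
    linarith
  have hcb : closedBall x₀ ρ ⊆ closedBall 0 (2 * ρ) :=
    closedBall_subset_closedBall' (by rw [dist_zero_right]; linarith)
  have hbb : ball x₀ ρ ⊆ ball 0 (2 * ρ) :=
    ball_subset_ball' (by rw [dist_zero_right]; linarith)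
  set a := m / (2 * h) with ha
  set β := m / h ^ 2 with hβ
  set α := 2 * m / ρ ^ 2 with hα
  have ha0 : 0 < a := by positivity
  have hβ0 : 0 < β := by positivity
  have hα0 : 0 < α := by positivity
  have hah : a = β * h / 2 := by rw [ha, hβ]; field_simp
  have hβh : β * h ^ 2 = m := by rw [hβ]; field_simp
  have hαρ : α * ρ ^ 2 = 2 * m := by rw [hα]; field_simp
  have hαβ : 4 * D * α ≤ β := by
    rw [hα, hβ, ← mul_div_assoc, div_le_div_iff₀ (by positivity) (by positivity)]
    nlinarith
  have hαβ' : 4 * α ≤ β := by nlinarith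
  have hαρ' : α * ρ ≤ β * h := by
    have h1 : α * ρ * ρ ≤ β * h * ρ := by nlinarith
    exact le_of_mul_le_mul_right h1 hρ
  have hcβ : 4 * c ≤ β := by
    rw [hβ, le_div_iff₀ (by positivity)]; exact hch
  have key := hsol.quadratic_comparison hκ hν
    (K := closedBall x₀ ρ ∩ {x | 0 ≤ inner ℝ ν x} ∩ {x | inner ℝ ν x ≤ h})
    (U := ball x₀ ρ ∩ {x | 0 < inner ℝ ν x} ∩ {x | inner ℝ ν x < h})
    (((isCompact_closedBall _ _).inter_right (isClosed_inner_nonneg ν)).inter_right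
      (isClosed_le (by fun_prop) continuous_const))
    ((isOpen_ball.inter (isOpen_inner_pos ν)).inter (isOpen_lt (by fun_prop) continuous_const))
    (fun z hz => ⟨⟨ball_subset_closedBall hz.1.1, show (0 : ℝ) ≤ inner ℝ ν z from le_of_lt hz.1.2⟩,
      show inner ℝ ν z ≤ h from le_of_lt hz.2⟩)
    (inter_subset_left.trans (inter_subset_inter_left _ hbb))
    (hw.mono (inter_subset_left.trans (inter_subset_inter_left _ hcb)))
    (x₀ := x₀) (a := a) (α := α) (β := β) (h := h) (ρ := ρ) hα0.le hβ0.le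
    (fun z hz => by
      have h1 : ‖z - x₀‖ ≤ ρ := by rw [← dist_eq_norm]; exact (mem_ball.1 hz.1.1).le
      have h2 : (0 : ℝ) < inner ℝ ν z := hz.1.2
      have h3 : inner ℝ ν z < h := hz.2
      exact ⟨by rw [abs_of_pos h2]; exact h3.le, h1⟩)
    (by
      rw [abs_of_pos ha0, hah]
      have h1 : κ * (β * h / 2 + β * h + α * ρ) ≤ κ * (5 / 2 * (β * h)) :=
        mul_le_mul_of_nonneg_left (by linarith) hκ
      have h2 := mul_le_mul_of_nonneg_right hκh hβ0.le
      nlinarith)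
    (fun z hz hzU => by
      have hzν : (0 : ℝ) ≤ inner ℝ ν z := hz.1.2
      have hzh : inner ℝ ν z ≤ h := hz.2
      have h1 : ‖z - x₀‖ ≤ ρ := by rw [← dist_eq_norm]; exact mem_closedBall.1 hz.1.1
      have h2 : 0 ≤ α / 2 * ‖z - x₀‖ ^ 2 := by positivity
      have h3 : a * inner ℝ ν z ≤ a * h := mul_le_mul_of_nonneg_left hzh ha0.le
      have h4 : β / 2 * inner ℝ ν z ^ 2 ≤ β / 2 * h ^ 2 :=
        mul_le_mul_of_nonneg_left (pow_le_pow_left₀ hzν hzh 2) (by positivity)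
      have h5 : a * h + β / 2 * h ^ 2 = m := by rw [hah]; linarith
      rcases hzν.eq_or_lt with hz0 | hzpos
      · have := h0 z (hcb hz.1.1) hzν
        rw [← hz0]
        linarith
      · rcases hzh.eq_or_lt with hzh' | hzlt
        · have := hslab z (hcb hz.1.1) hzh'
          linarith
        · have h6 : ‖z - x₀‖ = ρ := by
            refine le_antisymm h1 (not_lt.1 fun hlt => hzU ⟨⟨?_, hzpos⟩, hzlt⟩)
            rwa [mem_ball, dist_eq_norm]
          have := h0 z (hcb hz.1.1) hzν
          rw [h6]
          linarith)
    x ⟨⟨by rw [mem_closedBall, dist_eq_norm, hxx₀]; linarith, hxν⟩, hth⟩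
  refine le_trans ?_ key
  rw [hxx₀, ← ht]
  have h5 : α * t ^ 2 ≤ β * t ^ 2 := mul_le_mul_of_nonneg_right (by linarith) (by positivity)
  linarith

end HalfSpace

section BoundaryExpansion

variable {E : Type*} [NormedAddCommGroup E] [InnerProductSpace ℝ E] {D κ c : ℝ} {v : E → ℝ} {ν : E}

/-- Harnack chain inside a convex set. -/
theorem harnack_chain {w : E → ℝ} {C s m : ℝ} (hC1 : 1 ≤ C) {S : Set E}
    (hS : Convex ℝ S)
    (hharnack : ∀ y ∈ S, ∀ m', m ≤ m' → C * m' ≤ w y → ∀ x ∈ closedBall y s, m' ≤ w x)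
    (hm : 0 ≤ m) {x : E} (hx : x ∈ S) (N : ℕ) :
    ∀ y ∈ S, ‖x - y‖ ≤ N * s → C ^ N * m ≤ w y → m ≤ w x := by
  induction N with
  | zero =>
    intro y _ hxy hwy
    rw [Nat.cast_zero, zero_mul] at hxy
    have : x = y := by rwa [← sub_eq_zero, ← norm_le_zero_iff]
    simpa [this] using hwy
  | succ N ih =>
    intro y hy hxy hwy
    have hN : (0 : ℝ) < N + 1 := by positivity
    push_cast at hxy
    have hy' : y + (1 / ((N : ℝ) + 1)) • (x - y) ∈ S :=
      hS.add_smul_sub_mem hy hx ⟨by positivity, by rw [div_le_one hN]; linarith [N.cast_nonneg (α := ℝ)]⟩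
    refine ih _ hy' ?_ (hharnack y hy _ (le_mul_of_one_le_left hm (one_le_pow₀ hC1)) ?_ _ ?_)
    · have e1 : x - (y + (1 / ((N : ℝ) + 1)) • (x - y)) = ((N : ℝ) / (N + 1)) • (x - y) := by
        have : (N : ℝ) / (N + 1) = 1 - 1 / (N + 1) := by field_simp; ring
        rw [this, sub_smul, one_smul]; abel
      rw [e1, norm_smul, Real.norm_of_nonneg (by positivity)]
      refine (mul_le_mul_of_nonneg_left hxy (by positivity)).trans (le_of_eq ?_)
      field_simp
    · rwa [← mul_assoc, ← pow_succ']
    · rw [mem_closedBall, dist_eq_norm, add_sub_cancel_left, norm_smul,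
        Real.norm_of_nonneg (by positivity)]
      refine (mul_le_mul_of_nonneg_left hxy (by positivity)).trans (le_of_eq ?_)
      field_simp

variable [FiniteDimensional ℝ E]

/-- A nonnegative solution in a half ball that is comparable to the height at one non-tangential
point is bounded below linearly, with a slope that does not depend on the point. -/
theorem SupSol.exists_slope (hD : 1 ≤ D) (hκ : 0 ≤ κ) (hc : 0 ≤ c) (hν : ‖ν‖ = 1) {η : ℝ}
    (hη : 0 < η) : ∃ q > 0, ∃ r₀ > 0, ∀ (w : E → ℝ) (y : E), ‖y‖ ≤ r₀ → η * ‖y‖ < inner ℝ ν y →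
      SupSol D κ c (ball 0 (4 * ‖y‖) ∩ {x | 0 < inner ℝ ν x}) w →
      SupSol D κ c (ball 0 (4 * ‖y‖) ∩ {x | 0 < inner ℝ ν x}) (fun x => -w x) →
      ContinuousOn w (closedBall 0 (4 * ‖y‖) ∩ {x | 0 ≤ inner ℝ ν x}) →
      (∀ x ∈ closedBall (0 : E) (4 * ‖y‖), 0 ≤ inner ℝ ν x → 0 ≤ w x) →
      η * inner ℝ ν y ≤ w y →
      ∃ r > 0, ∀ x ∈ ball (0 : E) r, 0 ≤ inner ℝ ν x → q * inner ℝ ν x ≤ w x := by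
  have : Nontrivial E := ⟨⟨ν, 0, by rintro rfl; simp at hν⟩⟩
  obtain ⟨C, hC1, hC⟩ := SupSol.exists_harnack E hD
  set θ := 1 / (3 * D) with hθ
  have hθ0 : 0 < θ := by positivity
  have hθ1 : θ ≤ 1 / 3 := by
    rw [hθ, div_le_div_iff₀ (by positivity) (by positivity)]; linarith
  have hθD : 8 * D * θ ^ 2 ≤ 1 := by
    have : D * θ = 1 / 3 := by rw [hθ]; field_simp
    nlinarith
  set μ := min η θ with hμ
  have hμ0 : 0 < μ := lt_min hη hθ0
  have hμη : μ ≤ η := min_le_left _ _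
  have hμθ : μ ≤ θ := min_le_right _ _
  obtain ⟨N, hN⟩ := exists_nat_gt (48 / μ)
  rw [div_lt_iff₀ hμ0] at hN
  have hCN : 0 < C ^ N := by positivity
  set q := η ^ 2 / C ^ N with hq
  have hq0 : 0 < q := by positivity
  refine ⟨q / (2 * θ), by positivity, min (1 / (10 * (κ + 1))) (q / (4 * (c + 1))), by positivity, ?_⟩
  intro w y hyr hyη hsup hsub hw h0 hwy
  set r := ‖y‖ with hr
  have hr0 : 0 < r := by
    refine norm_pos_iff.2 ?_
    intro hy0
    rw [hr, hy0] at hyη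
    simp at hyη
  have hκr : 10 * κ * r ≤ 1 := by
    have h1 := hyr.trans (min_le_left _ _)
    rw [le_div_iff₀ (by positivity)] at h1
    have h2 : 0 ≤ r := hr0.le
    linarith
  have hcr : 4 * c * r ≤ q := by
    have h1 := hyr.trans (min_le_right _ _)
    rw [le_div_iff₀ (by positivity)] at h1
    have h2 : 0 ≤ r := hr0.le
    linarith
  have hcr2 : 4 * c * r ^ 2 ≤ q * r := by
    have h1 := mul_le_mul_of_nonneg_right hcr hr0.le
    rwa [mul_assoc _ r r, ← sq] at h1
  have hκr0 : 0 ≤ κ * r := by positivity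
  have hcr0 : 0 ≤ c * r ^ 2 := by positivity
  set s := μ * r / 2 with hs
  have hs0 : 0 < s := by positivity
  have hsr : s ≤ r / 6 := by
    have h1 := mul_le_mul_of_nonneg_right (hμθ.trans hθ1) hr0.le
    rw [hs]; linarith
  have hsball : ∀ z ∈ closedBall (0 : E) (2 * r) ∩ {x | μ * r ≤ inner ℝ ν x},
      closedBall z s ⊆ ball 0 (4 * r) ∩ {x | 0 < inner ℝ ν x} := by
    rintro z ⟨hz1, hz2⟩ x hx
    rw [mem_closedBall_zero_iff] at hz1
    have hz2' : μ * r ≤ inner ℝ ν z := hz2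
    rw [mem_closedBall, dist_eq_norm] at hx
    have h1 : ‖x‖ ≤ ‖x - z‖ + ‖z‖ := by simpa using norm_add_le (x - z) z
    have h2 := abs_real_inner_le_norm ν (x - z)
    rw [hν, one_mul, inner_sub_right] at h2
    have h3 := neg_le_of_abs_le h2
    refine ⟨mem_ball_zero_iff.2 (by linarith), ?_⟩
    have h4 : 0 < μ * r := by positivity
    change (0 : ℝ) < inner ℝ ν x
    linarith
  have hsub1 : ball (0 : E) (4 * r) ∩ {x | 0 < inner ℝ ν x} ⊆
      closedBall 0 (4 * r) ∩ {x | 0 ≤ inner ℝ ν x} := fun z hz =>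
    ⟨ball_subset_closedBall hz.1, show (0 : ℝ) ≤ inner ℝ ν z from le_of_lt hz.2⟩
  have hconv : Convex ℝ (closedBall (0 : E) (2 * r) ∩ {x | μ * r ≤ inner ℝ ν x}) :=
    (convex_closedBall _ _).inter
      (convex_halfSpace_ge (IsLinearMap.mk (inner_add_right ν) fun a x => by
        rw [inner_smul_right, smul_eq_mul]) _)
  have hyS : y ∈ closedBall (0 : E) (2 * r) ∩ {x | μ * r ≤ inner ℝ ν x} := by
    refine ⟨mem_closedBall_zero_iff.2 (by linarith), ?_⟩
    exact (mul_le_mul_of_nonneg_right hμη hr0.le).trans hyη.le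
  have hslab : ∀ x ∈ closedBall (0 : E) (2 * r), inner ℝ ν x = θ * r → q * r ≤ w x := by
    intro x hx hxθ
    have hxS : x ∈ closedBall (0 : E) (2 * r) ∩ {x | μ * r ≤ inner ℝ ν x} := by
      refine ⟨hx, ?_⟩
      change μ * r ≤ inner ℝ ν x
      rw [hxθ]
      exact mul_le_mul_of_nonneg_right hμθ hr0.le
    refine harnack_chain hC1 (s := s / 8) hconv ?_ (by positivity) hxS N y hyS ?_ ?_
    · intro z hz m' hm' hwz
      have hm0 : 0 < m' := lt_of_lt_of_le (by positivity) hm'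
      have hs2 : c * s ^ 2 ≤ c * r ^ 2 :=
        mul_le_mul_of_nonneg_left (pow_le_pow_left₀ hs0.le (by linarith) 2) hc
      have hs3 : κ * s ≤ κ * r := mul_le_mul_of_nonneg_left (by linarith) hκ
      have hb := ball_subset_closedBall.trans (hsball z hz)
      exact hC w z κ c s m' hs0 hm0 (by linarith) (by linarith)
        (hsup.mono le_rfl le_rfl hb) (hsub.mono le_rfl le_rfl hb)
        (hw.mono ((hsball z hz).trans hsub1))
        (fun x hx => h0 x (hsub1 (hsball z hz hx)).1 (hsub1 (hsball z hz hx)).2) hwz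
    · have h1 := norm_sub_le x y
      rw [mem_closedBall_zero_iff] at hx
      have h2 : N * (s / 8) = N * μ * r / 16 := by rw [hs]; ring
      rw [h2]
      have h3 := mul_le_mul_of_nonneg_right hN.le hr0.le
      linarith
    · rw [hq, div_mul_eq_mul_div, mul_div_cancel₀ _ hCN.ne']
      refine le_trans ?_ hwy
      have h1 := mul_le_mul_of_nonneg_left hyη.le hη.le
      rwa [← mul_assoc, ← sq] at h1
  have h2r : 2 * r ≤ 4 * r := by linarith
  have hθr : θ * r ≤ r := mul_le_of_le_one_left hr0.le (by linarith)
  refine ⟨θ * r, by positivity, fun x hx hxν => ?_⟩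
  have key := SupSol.linear_growth (c := c) hD hκ hν (ρ := r) (h := θ * r) (m := q * r) (by positivity)
    (by
      have h1 := mul_le_mul_of_nonneg_right hθD (sq_nonneg r)
      rw [mul_pow]; linarith) hr0 (by positivity)
    (by
      have h1 : κ * (θ * r) ≤ κ * r := mul_le_mul_of_nonneg_left hθr hκ
      linarith)
    (by
      have h1 : c * (θ * r) ^ 2 ≤ c * r ^ 2 :=
        mul_le_mul_of_nonneg_left (pow_le_pow_left₀ (by positivity) hθr 2) hc
      linarith)
    (hsup.mono le_rfl le_rfl (inter_subset_inter_left _ (ball_subset_ball h2r)))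
    (hw.mono (inter_subset_inter_left _ (closedBall_subset_closedBall h2r)))
    (fun x hx => h0 x (closedBall_subset_closedBall h2r hx)) hslab x hx hxν
  rwa [show q / (2 * θ) = q * r / (2 * (θ * r)) by field_simp]

/-- Boundary expansion: a solution in a half ball that is nonnegative on the flat boundary either
grows superlinearly or has a non-tangential linear expansion. -/
theorem SupSol.boundary_expansion (hD : 1 ≤ D) (hκ : 0 ≤ κ) (hc : 0 ≤ c) (hν : ‖ν‖ = 1)
    {R m : ℝ} (hR : 0 < R) (hm : 0 ≤ m)
    (hsup : SupSol D κ c (ball 0 R ∩ {x | 0 < inner ℝ ν x}) v)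
    (hsub : SupSol D κ c (ball 0 R ∩ {x | 0 < inner ℝ ν x}) (fun x => -v x))
    (hv : ContinuousOn v (closedBall 0 R ∩ {x | 0 ≤ inner ℝ ν x}))
    (h0 : ∀ x ∈ closedBall (0 : E) R, inner ℝ ν x = (0 : ℝ) → 0 ≤ v x)
    (hlow : ∀ x ∈ closedBall (0 : E) R, 0 ≤ inner ℝ ν x → -m ≤ v x) :
    (∀ p : ℝ, ∃ r > 0, ∀ x ∈ ball (0 : E) r, 0 ≤ inner ℝ ν x → p * inner ℝ ν x ≤ v x) ∨
    ∃ p : ℝ, ∀ η > 0, ∃ r > 0,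
      (∀ x ∈ ball (0 : E) r, 0 ≤ inner ℝ ν x → (p - η) * inner ℝ ν x ≤ v x) ∧
      ∀ x ∈ ball (0 : E) r, η * ‖x‖ < inner ℝ ν x → v x ≤ (p + η) * inner ℝ ν x := by
  set S := {p : ℝ | ∃ r > 0, ∀ x ∈ ball (0 : E) r, 0 ≤ inner ℝ ν x → p * inner ℝ ν x ≤ v x} with hS
  have hSne : S.Nonempty :=
    SupSol.exists_linear_lower_bound (by linarith) hκ hc hν hR hm hsup hv h0 hlow
  have hSdown : ∀ p ∈ S, ∀ q ≤ p, q ∈ S := by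
    rintro p ⟨r, hr, hp⟩ q hq
    exact ⟨r, hr, fun x hx hxν => (mul_le_mul_of_nonneg_right hq hxν).trans (hp x hx hxν)⟩
  by_cases hbdd : BddAbove S
  swap
  · left
    intro p
    rw [not_bddAbove_iff] at hbdd
    obtain ⟨q, hq, hpq⟩ := hbdd p
    exact hSdown q hq p hpq.le
  right
  set P := sSup S with hP
  have hlt : ∀ q < P, q ∈ S := fun q hq => by
    obtain ⟨p, hp, hqp⟩ := exists_lt_of_lt_csSup hSne hq
    exact hSdown p hp q hqp.le
  refine ⟨P, fun η hη => ?_⟩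
  obtain ⟨r₁, hr₁, hlow₁⟩ := hlt (P - η) (by linarith)
  suffices h : ∃ r > 0, ∀ x ∈ ball (0 : E) r, η * ‖x‖ < inner ℝ ν x → v x ≤ (P + η) * inner ℝ ν x by
    obtain ⟨r₂, hr₂, hup⟩ := h
    exact ⟨min r₁ r₂, lt_min hr₁ hr₂, fun x hx => hlow₁ x (ball_subset_ball (min_le_left _ _) hx),
      fun x hx => hup x (ball_subset_ball (min_le_right _ _) hx)⟩
  by_contra! hcon
  obtain ⟨q, hq, r₀, hr₀, key⟩ := SupSol.exists_slope (c := c + κ * (|P| + 1)) hD hκ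
    (by positivity) hν hη
  set δ := min 1 (q / 2) with hδ
  have hδ0 : 0 < δ := by positivity
  have hδ1 : δ ≤ 1 := min_le_left _ _
  have hδq : δ < q := (min_le_right _ _).trans_lt (by linarith)
  obtain ⟨r₂, hr₂, hlow₂⟩ := hlt (P - δ) (by linarith)
  obtain ⟨y, hy, hyη, hvy⟩ := hcon (min r₀ (min (r₂ / 8) (R / 4))) (by positivity)
  rw [mem_ball_zero_iff, lt_min_iff, lt_min_iff] at hy
  obtain ⟨hy0, hy2, hyR⟩ := hy
  have hyν : (0 : ℝ) < inner ℝ ν y := lt_of_le_of_lt (by positivity) hyη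
  have hyR' : 4 * ‖y‖ ≤ R := by linarith
  have hnorm : ‖-(P - δ) • ν‖ ≤ |P| + 1 := by
    rw [norm_smul, hν, mul_one, norm_neg, Real.norm_eq_abs]
    refine (abs_sub _ _).trans ?_
    rw [abs_of_pos hδ0]; linarith
  have hnorm' : ‖(P - δ) • ν‖ ≤ |P| + 1 := by rwa [neg_smul, norm_neg] at hnorm
  have hmono := inter_subset_inter_left {x : E | 0 < inner ℝ ν x} (ball_subset_ball (x := 0) hyR')
  obtain ⟨r, hr, hfin⟩ := key (fun x => v x + inner ℝ (-(P - δ) • ν) x) y hy0.le hyη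
    ((hsup.add_inner hκ _).mono le_rfl (by gcongr) hmono)
    (by
      have h1 := (hsub.add_inner hκ ((P - δ) • ν)).mono le_rfl
        (show c + κ * ‖(P - δ) • ν‖ ≤ c + κ * (|P| + 1) by gcongr) hmono
      convert h1 using 2 with x
      rw [neg_smul, inner_neg_left]; ring)
    ((hv.mono (inter_subset_inter_left _ (closedBall_subset_closedBall hyR'))).add (by fun_prop))
    (fun x hx hxν => by
      rw [inner_smul_left]
      simp only [conj_trivial]
      have := hlow₂ x (by
        rw [mem_closedBall_zero_iff] at hx
        rw [mem_ball_zero_iff]; linarith) hxν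
      linarith)
    (by
      rw [inner_smul_left]
      simp only [conj_trivial]
      have : 0 ≤ δ * inner ℝ ν y := by positivity
      linarith)
  have hmem : P - δ + q ∈ S := by
    refine ⟨r, hr, fun x hx hxν => ?_⟩
    have := hfin x hx hxν
    rw [inner_smul_left] at this
    simp only [conj_trivial] at this
    linarith
  have := le_csSup hbdd hmem
  linarith

end BoundaryExpansion

section Viscosity

/-- The quadratic polynomial with value `k`, gradient `b` and Hessian `β e ⊗ e - α I` at `x₀`. -/
def quadPoly {E : Type*} [NormedAddCommGroup E] [InnerProductSpace ℝ E] (k : ℝ) (b e x₀ : E)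
    (α β : ℝ) (x : E) : ℝ :=
  k + inner ℝ b (x - x₀) + β / 2 * inner ℝ e (x - x₀) ^ 2 - α / 2 * ‖x - x₀‖ ^ 2

section

variable {E : Type*} [NormedAddCommGroup E] [InnerProductSpace ℝ E] (k : ℝ) (b e x₀ : E) (α β : ℝ)

theorem contDiff_quadPoly : ContDiff ℝ 2 (quadPoly k b e x₀ α β) := by
  have h1 : ContDiff ℝ 2 fun x : E => ‖x - x₀‖ ^ 2 := (contDiff_id.sub contDiff_const).norm_sq ℝ
  have h2 : ∀ a : E, ContDiff ℝ 2 fun x : E => (inner ℝ a (x - x₀) : ℝ) := fun a =>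
    contDiff_const.inner ℝ (contDiff_id.sub contDiff_const)
  exact ((contDiff_const.add (h2 b)).add (contDiff_const.mul ((h2 e).pow 2))).sub
    (contDiff_const.mul h1)

theorem hasFDerivAt_quadPoly (x : E) : HasFDerivAt (quadPoly k b e x₀ α β)
    (innerSL ℝ b + (β * inner ℝ e (x - x₀)) • innerSL ℝ e - α • innerSL ℝ (x - x₀)) x := by
  have h0 : HasFDerivAt (fun x : E => x - x₀) (ContinuousLinearMap.id ℝ E) x :=
    (hasFDerivAt_id x).sub_const x₀
  have h1 : ∀ a : E, HasFDerivAt (fun x : E => (inner ℝ a (x - x₀) : ℝ)) (innerSL ℝ a) x := fun a =>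
    (innerSL ℝ a).hasFDerivAt.comp x h0
  have h2 := h0.norm_sq
  have h3 := (((h1 b).const_add k).add (((h1 e).pow 2).const_mul (β / 2))).sub (h2.const_mul (α / 2))
  refine h3.congr_fderiv ?_
  ext y
  simp
  ring

theorem iteratedFDeriv_two_quadPoly (y z : E) :
    iteratedFDeriv ℝ 2 (quadPoly k b e x₀ α β) x₀ ![y, z] =
      β * inner ℝ e y * inner ℝ e z - α * inner ℝ y z := by
  have h1 : fderiv ℝ (quadPoly k b e x₀ α β) = fun x =>
      innerSL ℝ b + (β * inner ℝ e (x - x₀)) • innerSL ℝ e - α • innerSL ℝ (x - x₀) :=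
    funext fun x => (hasFDerivAt_quadPoly k b e x₀ α β x).fderiv
  have h0 : HasFDerivAt (fun x : E => x - x₀) (ContinuousLinearMap.id ℝ E) x₀ :=
    (hasFDerivAt_id x₀).sub_const x₀
  have h2 : HasFDerivAt (fun x : E => (inner ℝ e (x - x₀) : ℝ)) (innerSL ℝ e) x₀ :=
    (innerSL ℝ e).hasFDerivAt.comp x₀ h0
  have h3 : HasFDerivAt (fun x : E => innerSL ℝ (x - x₀)) (innerSL ℝ) x₀ :=
    (innerSL ℝ (E := E)).hasFDerivAt.comp x₀ h0
  have h4 : HasFDerivAt (fun x : E =>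
      innerSL ℝ b + (β * inner ℝ e (x - x₀)) • innerSL ℝ e - α • innerSL ℝ (x - x₀)) _ x₀ :=
    (((h2.const_mul β).smul_const (innerSL ℝ e)).const_add (innerSL ℝ b)).sub (h3.const_smul α)
  rw [iteratedFDeriv_two_apply, h1, h4.fderiv]
  simp
  exact Or.inl rfl

end

variable {n : ℕ} {l L : ℝ}

theorem gradient_quadPoly (k : ℝ) (b e x₀ : Euc n) (α β : ℝ) :
    gradient (quadPoly k b e x₀ α β) x₀ = b := by
  refine HasGradientAt.gradient ?_
  have h := hasFDerivAt_quadPoly k b e x₀ α β x₀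
  simp only [sub_self, inner_zero_right, mul_zero, zero_smul, add_zero, map_zero, smul_zero,
    sub_zero] at h
  exact h

theorem hessianMatrix_quadPoly (k : ℝ) (b e x₀ : Euc n) (α β : ℝ) :
    hessianMatrix (quadPoly k b e x₀ α β) x₀ =
      β • Matrix.vecMulVec e e - α • (1 : Matrix (Fin n) (Fin n) ℝ) := by
  ext i j
  rw [hessianMatrix, Matrix.of_apply, iteratedFDeriv_two_quadPoly]
  simp only [EuclideanSpace.inner_single_right, Matrix.sub_apply, Matrix.smul_apply,
    Matrix.vecMulVec_apply, Matrix.one_apply, smul_eq_mul]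
  by_cases hij : i = j
  · subst hij; simp [mul_assoc]
  · simp [hij, Ne.symm hij, mul_assoc]

theorem trace_mul_le {A : Matrix (Fin n) (Fin n) ℝ} (hA : A ∈ pucciSet n l L) {e : Euc n}
    (he : ‖e‖ = 1) {α β : ℝ} (hα : 0 ≤ α) (hβ : 0 ≤ β) :
    -(A * (β • Matrix.vecMulVec e e - α • (1 : Matrix (Fin n) (Fin n) ℝ))).trace ≤
      α * (n * L) - β * l := by
  obtain ⟨h1, h2⟩ := hA
  have h3 : A.trace ≤ n * L := by
    have := h2.trace_nonneg
    rw [Matrix.trace_sub, Matrix.trace_smul, Matrix.trace_one, Fintype.card_fin, smul_eq_mul] at this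
    linarith
  have h4 : l ≤ (A * Matrix.vecMulVec e e).trace := by
    have h5 := h1.dotProduct_mulVec_nonneg e.ofLp
    have h6 : e.ofLp ⬝ᵥ e.ofLp = 1 := by
      have := EuclideanSpace.real_norm_sq_eq e
      rw [he, one_pow] at this
      simp [dotProduct, this, ← sq]
    rw [Matrix.mul_vecMulVec, Matrix.trace_vecMulVec, dotProduct_comm]
    rw [Matrix.sub_mulVec, Matrix.smul_mulVec, Matrix.one_mulVec, dotProduct_sub, dotProduct_smul,
      star_trivial, h6, smul_eq_mul, mul_one] at h5
    linarith
  rw [Matrix.mul_sub, Matrix.trace_sub, Matrix.mul_smul, Matrix.mul_smul, Matrix.mul_one,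
    Matrix.trace_smul, Matrix.trace_smul, smul_eq_mul, smul_eq_mul]
  have h5 := mul_le_mul_of_nonneg_left h3 hα
  have h6 := mul_le_mul_of_nonneg_left h4 hβ
  linarith

theorem pucciSet_nonempty (hlL : l ≤ L) : (pucciSet n l L).Nonempty := by
  refine ⟨l • 1, ?_, ?_⟩
  · rw [sub_self]; exact Matrix.PosSemidef.zero
  · rw [← sub_smul]; exact Matrix.PosSemidef.one.smul (sub_nonneg.2 hlL)

theorem ViscPucciSuper.supSol {V : Set (Euc n)} {u : Euc n → ℝ} (hu : ViscPucciSuper l L V u)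
    (hl : 0 < l) (hlL : l ≤ L) (hV : IsOpen V) {m : ℝ} (hm : ∀ x ∈ V, |u x| ≤ m) :
    SupSol (n * L / l) (L / l) ((L * m + L) / l) V u := by
  intro x₀ hx₀ b e α β hα hβ he ht
  obtain ⟨r, hr, hrV⟩ := Metric.eventually_nhds_iff_ball.1 (ht.and (hV.mem_nhds hx₀))
  have h1 := hu x₀ (quadPoly (u x₀) b e x₀ α β) r hr (fun x hx => (hrV x hx).2)
    (contDiff_quadPoly _ _ _ _ _ _).contDiffOn (fun x hx => (hrV x hx).1) (by simp [quadPoly])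
  rw [gradient_quadPoly, hessianMatrix_quadPoly] at h1
  have h2 : pucciPlus l L (β • Matrix.vecMulVec e e - α • (1 : Matrix (Fin n) (Fin n) ℝ)) ≤
      α * (n * L) - β * l := by
    refine csSup_le ((pucciSet_nonempty hlL).image _) ?_
    rintro _ ⟨A, hA, rfl⟩
    exact trace_mul_le hA he hα hβ
  have h3 : max (u x₀) 0 ≤ m :=
    max_le ((le_abs_self _).trans (hm x₀ hx₀)) ((abs_nonneg _).trans (hm x₀ hx₀))
  have h4 := mul_le_mul_of_nonneg_left h3 (hl.le.trans hlL)
  rw [div_mul_eq_mul_div, div_mul_eq_mul_div, ← add_div, ← add_div, le_div_iff₀ hl]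
  linarith

theorem ViscPucciSub.supSol_neg {V : Set (Euc n)} {u : Euc n → ℝ} (hu : ViscPucciSub l L V u)
    (hl : 0 < l) (hlL : l ≤ L) (hV : IsOpen V) {m : ℝ} (hm : ∀ x ∈ V, |u x| ≤ m) :
    SupSol (n * L / l) (L / l) ((L * m + L) / l) V (fun x => -u x) := by
  intro x₀ hx₀ b e α β hα hβ he ht
  obtain ⟨r, hr, hrV⟩ := Metric.eventually_nhds_iff_ball.1 (ht.and (hV.mem_nhds hx₀))
  have h1 := hu x₀ (quadPoly (u x₀) (-b) e x₀ (-α) (-β)) r hr (fun x hx => (hrV x hx).2)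
    (contDiff_quadPoly _ _ _ _ _ _).contDiffOn (fun x hx => by
      have := (hrV x hx).1
      rw [quadPoly, inner_neg_left]
      linarith) (by simp [quadPoly])
  rw [gradient_quadPoly, hessianMatrix_quadPoly, norm_neg] at h1
  have h2 : β * l - α * (n * L) ≤
      pucciMinus l L (-β • Matrix.vecMulVec e e - -α • (1 : Matrix (Fin n) (Fin n) ℝ)) := by
    refine le_csInf ((pucciSet_nonempty hlL).image _) ?_
    rintro _ ⟨A, hA, rfl⟩
    have h3 := trace_mul_le hA he hα hβ
    have h4 : -β • Matrix.vecMulVec e e - -α • (1 : Matrix (Fin n) (Fin n) ℝ) =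
        -(β • Matrix.vecMulVec e e - α • (1 : Matrix (Fin n) (Fin n) ℝ)) := by
      rw [neg_smul, neg_smul]; abel
    simp only [h4, Matrix.mul_neg, Matrix.trace_neg]
    linarith
  have h3 : max (-u x₀) 0 ≤ m :=
    max_le ((neg_le_abs _).trans (hm x₀ hx₀)) ((abs_nonneg _).trans (hm x₀ hx₀))
  have h4 := mul_le_mul_of_nonneg_left h3 (hl.le.trans hlL)
  rw [div_mul_eq_mul_div, div_mul_eq_mul_div, ← add_div, ← add_div, le_div_iff₀ hl]
  linarith

end Viscosity

section Reduction

variable {E : Type*} [NormedAddCommGroup E] [InnerProductSpace ℝ E]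
  {D κ c : ℝ} {V : Set E} {w : E → ℝ}

theorem SupSol.add_semiconcave (h : SupSol D κ c V w) (hκ : 0 ≤ κ) {K G : ℝ}
    (hK : 0 ≤ K) {ψ : E → ℝ}
    (hψ : ∀ x₀ ∈ V, ∃ g : E, ‖g‖ ≤ G ∧
      ∀ x, ψ x ≤ ψ x₀ + inner ℝ g (x - x₀) + K / 2 * ‖x - x₀‖ ^ 2) :
    SupSol D κ (c + D * K + κ * G) V (fun x => w x + ψ x) := by
  intro x₀ hx₀ b e α β hα hβ he ht
  obtain ⟨g, hg, hg'⟩ := hψ x₀ hx₀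
  have h1 := h x₀ hx₀ (b - g) e (α + K) β (add_nonneg hα hK) hβ he (by
    filter_upwards [ht] with x hx
    have := hg' x
    rw [inner_sub_left]
    linarith)
  have h2 := mul_le_mul_of_nonneg_left ((norm_sub_le b g).trans (add_le_add_right hg _)) hκ
  linarith

variable {ν : E}

/-- The paraboloid `a |x'|² - ⟨P, x⟩`, where `x'` is the component of `x` orthogonal to `ν`. -/
def cylParaboloid (a : ℝ) (ν P : E) (x : E) : ℝ :=
  a * (‖x‖ ^ 2 - inner ℝ ν x ^ 2) - inner ℝ P x

theorem continuous_cylParaboloid (a : ℝ) (ν P : E) : Continuous (cylParaboloid a ν P) := by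
  unfold cylParaboloid
  fun_prop

theorem cylParaboloid_expansion (a : ℝ) (P x₀ x : E) :
    cylParaboloid a ν P x = cylParaboloid a ν P x₀ +
      inner ℝ ((2 * a) • (x₀ - (inner ℝ ν x₀ : ℝ) • ν) - P) (x - x₀) +
      a * (‖x - x₀‖ ^ 2 - inner ℝ ν (x - x₀) ^ 2) := by
  obtain ⟨y, rfl⟩ : ∃ y, x = x₀ + y := ⟨x - x₀, by abel⟩
  simp only [cylParaboloid, add_sub_cancel_left, inner_sub_left, inner_smul_left, inner_add_right,
    norm_add_sq_real, RCLike.conj_to_real]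
  ring

theorem norm_gradient_cylParaboloid_le {a : ℝ} (ha : 0 ≤ a) (hν : ‖ν‖ = 1) (P : E) {x₀ : E}
    (hx₀ : ‖x₀‖ ≤ 1) : ‖(2 * a) • (x₀ - (inner ℝ ν x₀ : ℝ) • ν) - P‖ ≤ 2 * a + ‖P‖ := by
  refine (norm_sub_le _ _).trans (add_le_add_left ?_ _)
  rw [norm_smul, Real.norm_of_nonneg (by positivity)]
  exact mul_le_of_le_one_right (by positivity) ((norm_sub_inner_smul_le hν x₀).trans hx₀)

theorem SupSol.add_cylParaboloid (h : SupSol D κ c V w) (hκ : 0 ≤ κ) (hν : ‖ν‖ = 1)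
    (hV : V ⊆ closedBall 0 1) {a : ℝ} (ha : 0 ≤ a) (P : E) :
    SupSol D κ (c + D * (2 * a) + κ * (2 * a + ‖P‖)) V (fun x => w x + cylParaboloid a ν P x) := by
  refine h.add_semiconcave hκ (by positivity) fun x₀ hx₀ =>
    ⟨_, norm_gradient_cylParaboloid_le ha hν P (mem_closedBall_zero_iff.1 (hV hx₀)), fun x => ?_⟩
  rw [cylParaboloid_expansion a P x₀ x]
  have := mul_nonneg ha (sq_nonneg (inner ℝ ν (x - x₀) : ℝ))
  linarith

theorem SupSol.sub_cylParaboloid (h : SupSol D κ c V w) (hκ : 0 ≤ κ) (hν : ‖ν‖ = 1)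
    (hV : V ⊆ closedBall 0 1) {a : ℝ} (ha : 0 ≤ a) (P : E) :
    SupSol D κ (c + D * 0 + κ * (2 * a + ‖P‖)) V (fun x => w x + -cylParaboloid a ν P x) := by
  refine h.add_semiconcave hκ le_rfl fun x₀ hx₀ =>
    ⟨_, (norm_neg _).trans_le (norm_gradient_cylParaboloid_le ha hν P
      (mem_closedBall_zero_iff.1 (hV hx₀))), fun x => ?_⟩
  rw [cylParaboloid_expansion a P x₀ x, inner_neg_left]
  have h1 : (inner ℝ ν (x - x₀) : ℝ) ^ 2 ≤ ‖x - x₀‖ ^ 2 := by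
    rw [sq_le_sq, abs_norm]
    simpa [hν] using abs_real_inner_le_norm ν (x - x₀)
  have := mul_nonneg ha (sub_nonneg.2 h1)
  linarith

theorem half_closedBall_subset_closure (hν : ‖ν‖ = 1) :
    closedBall 0 (1 / 2) ∩ {x : E | 0 ≤ inner ℝ ν x} ⊆
      closure (ball 0 1 ∩ {x : E | 0 < inner ℝ ν x}) := by
  rintro x ⟨hx, hx'⟩
  rw [mem_closedBall_zero_iff] at hx
  change 0 ≤ inner ℝ ν x at hx'
  refine Metric.mem_closure_iff.2 fun δ hδ => ⟨x + min (δ / 2) (1 / 4) • ν, ⟨?_, ?_⟩, ?_⟩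
  all_goals
    have h1 : 0 < min (δ / 2) (1 / 4) := lt_min (by positivity) (by norm_num)
    have h2 : ‖min (δ / 2) (1 / 4) • ν‖ = min (δ / 2) (1 / 4) := by
      rw [norm_smul, hν, mul_one, Real.norm_of_nonneg h1.le]
  · rw [mem_ball_zero_iff]
    have := norm_add_le x (min (δ / 2) (1 / 4) • ν)
    have := min_le_right (δ / 2) (1 / 4)
    linarith
  · change 0 < inner ℝ ν _
    rw [inner_add_right, inner_smul_right, real_inner_self_eq_norm_sq, hν]
    linarith
  · rw [dist_self_add_right, h2]
    have := min_le_left (δ / 2) (1 / 4)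
    linarith

end Reduction

theorem ViscPucciSuper.mono {n : ℕ} {l L : ℝ} {V V' : Set (Euc n)} {u : Euc n → ℝ}
    (h : ViscPucciSuper l L V u) (hV : V' ⊆ V) : ViscPucciSuper l L V' u :=
  fun x₀ φ r hr hb => h x₀ φ r hr (hb.trans hV)

theorem ViscPucciSub.mono {n : ℕ} {l L : ℝ} {V V' : Set (Euc n)} {u : Euc n → ℝ}
    (h : ViscPucciSub l L V u) (hV : V' ⊆ V) : ViscPucciSub l L V' u :=
  fun x₀ φ r hr hb => h x₀ φ r hr (hb.trans hV)

theorem cylParaboloid_single_last {n : ℕ} (a : ℝ) (p' : Euc n) (x : Euc (n + 1)) :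
    cylParaboloid a (EuclideanSpace.single (Fin.last n) 1)
      (WithLp.toLp 2 (Fin.snoc p'.ofLp 0 : Fin (n + 1) → ℝ)) x =
      a * (∑ i : Fin n, (x i.castSucc) ^ 2) - ∑ i : Fin n, p' i * x i.castSucc := by
  have h1 : ‖x‖ ^ 2 = ∑ i : Fin n, (x i.castSucc) ^ 2 + x (Fin.last n) ^ 2 := by
    rw [EuclideanSpace.real_norm_sq_eq, Fin.sum_univ_castSucc]
  have h2 : inner ℝ (WithLp.toLp 2 (Fin.snoc p'.ofLp 0 : Fin (n + 1) → ℝ)) x =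
      ∑ i : Fin n, p' i * x i.castSucc := by
    rw [PiLp.inner_apply, Fin.sum_univ_castSucc]
    simp [mul_comm]
  have h3 : inner ℝ (EuclideanSpace.single (Fin.last n) 1) x = x (Fin.last n) := by
    simp [EuclideanSpace.inner_single_left]
  rw [cylParaboloid, h1, h2, h3, add_sub_cancel_right]

theorem statement_11 {n : ℕ} (lam Lam ε : ℝ) (hlam : 0 < lam) (hLam : lam ≤ Lam)
    (hε : ε ∈ Ioo (0 : ℝ) 1) (p' : Euc n) (hp' : ‖p'‖ ≤ Lam)
    (u : Euc (n + 1) → ℝ)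
    (huC : ContinuousOn u (closure (ball 0 1 ∩ {x : Euc (n + 1) | 0 < x (Fin.last n)})))
    (hsup : ViscPucciSuper lam Lam (ball 0 1 ∩ {x | 0 < x (Fin.last n)}) u)
    (hsub : ViscPucciSub lam Lam (ball 0 1 ∩ {x | 0 < x (Fin.last n)}) u)
    (hbdry : ∀ x ∈ ball (0 : Euc (n + 1)) 1, x (Fin.last n) = 0 →
      -(1 / (2 * ε)) * (∑ i : Fin n, (x i.castSucc) ^ 2) + (∑ i : Fin n, p' i * x i.castSucc) ≤ u x) :
    (∀ pn : ℝ, ∃ r ∈ Ioo (0 : ℝ) 1, ∀ x ∈ ball (0 : Euc (n + 1)) r, 0 ≤ x (Fin.last n) →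
      -(1 / (2 * ε)) * (∑ i : Fin n, (x i.castSucc) ^ 2) + (∑ i : Fin n, p' i * x i.castSucc) + pn * x (Fin.last n) ≤ u x) ∨
    (∃ pn : ℝ, ∀ η : ℝ, 0 < η → ∃ r ∈ Ioo (0 : ℝ) 1,
      (∀ x ∈ ball (0 : Euc (n + 1)) r, 0 ≤ x (Fin.last n) →
        -η * x (Fin.last n) ≤ u x - (-(1 / (2 * ε)) * (∑ i : Fin n, (x i.castSucc) ^ 2) + (∑ i : Fin n, p' i * x i.castSucc) + pn * x (Fin.last n))) ∧
      (∀ x ∈ ball (0 : Euc (n + 1)) r, η * ‖x‖ < x (Fin.last n) →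
        u x - (-(1 / (2 * ε)) * (∑ i : Fin n, (x i.castSucc) ^ 2) + (∑ i : Fin n, p' i * x i.castSucc) + pn * x (Fin.last n)) ≤ η * x (Fin.last n))) := by
  obtain ⟨hε0, -⟩ := hε
  set ν : Euc (n + 1) := EuclideanSpace.single (Fin.last n) 1 with hνdef
  have hν : ‖ν‖ = 1 := by simp [hνdef]
  have hin : ∀ x : Euc (n + 1), inner ℝ ν x = x (Fin.last n) := fun x => by
    simp [hνdef, EuclideanSpace.inner_single_left]
  set P : Euc (n + 1) := WithLp.toLp 2 (Fin.snoc p'.ofLp 0 : Fin (n + 1) → ℝ) with hPdef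
  set a : ℝ := 1 / (2 * ε) with hadef
  have ha : 0 ≤ a := by positivity
  have hψ : ∀ x : Euc (n + 1), cylParaboloid a ν P x =
      a * (∑ i : Fin n, (x i.castSucc) ^ 2) - ∑ i : Fin n, p' i * x i.castSucc :=
    cylParaboloid_single_last a p'
  have hS : {x : Euc (n + 1) | 0 < x (Fin.last n)} = {x | 0 < inner ℝ ν x} := by simp only [hin]
  rw [hS] at huC hsup hsub
  have hK := huC.mono (half_closedBall_subset_closure hν)
  have hcpt : IsCompact (closedBall 0 (1 / 2) ∩ {x : Euc (n + 1) | 0 ≤ inner ℝ ν x}) :=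
    (isCompact_closedBall _ _).inter_right (isClosed_inner_nonneg ν)
  obtain ⟨m₁, hm₁⟩ := hcpt.exists_bound_of_continuousOn hK
  have hvC : ContinuousOn (fun x => u x + cylParaboloid a ν P x)
      (closedBall 0 (1 / 2) ∩ {x : Euc (n + 1) | 0 ≤ inner ℝ ν x}) :=
    hK.add (continuous_cylParaboloid a ν P).continuousOn
  obtain ⟨m₂, hm₂⟩ := hcpt.exists_bound_of_continuousOn hvC
  have h0K : (0 : Euc (n + 1)) ∈ closedBall 0 (1 / 2) ∩ {x : Euc (n + 1) | 0 ≤ inner ℝ ν x} :=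
    ⟨mem_closedBall_self (by norm_num), show (0 : ℝ) ≤ inner ℝ ν 0 by simp⟩
  have hm₁0 : 0 ≤ m₁ := (norm_nonneg _).trans (hm₁ 0 h0K)
  have hm₂0 : 0 ≤ m₂ := (norm_nonneg _).trans (hm₂ 0 h0K)
  have hLam0 : 0 < Lam := hlam.trans_le hLam
  have hVo : IsOpen (ball 0 (1 / 2) ∩ {x : Euc (n + 1) | 0 < inner ℝ ν x}) :=
    isOpen_ball.inter (isOpen_inner_pos ν)
  have hVsub : ball 0 (1 / 2) ∩ {x : Euc (n + 1) | 0 < inner ℝ ν x} ⊆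
      ball 0 1 ∩ {x : Euc (n + 1) | 0 < inner ℝ ν x} :=
    inter_subset_inter_left _ (ball_subset_ball (by norm_num))
  have hV1 : ball 0 (1 / 2) ∩ {x : Euc (n + 1) | 0 < inner ℝ ν x} ⊆ closedBall 0 1 :=
    (hVsub.trans inter_subset_left).trans ball_subset_closedBall
  have hVm : ∀ x ∈ ball 0 (1 / 2) ∩ {x : Euc (n + 1) | 0 < inner ℝ ν x}, |u x| ≤ m₁ := fun x hx =>
    hm₁ x ⟨ball_subset_closedBall hx.1, (show (0 : ℝ) < inner ℝ ν x from hx.2).le⟩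
  have hκ : 0 ≤ Lam / lam := by positivity
  have hD : 1 ≤ ((n + 1 : ℕ) : ℝ) * Lam / lam := by
    rw [le_div_iff₀ hlam]
    have : (1 : ℝ) ≤ ((n + 1 : ℕ) : ℝ) := by exact_mod_cast Nat.succ_pos n
    linarith [mul_le_mul_of_nonneg_right this hLam0.le]
  have h1 := ((hsup.mono hVsub).supSol hlam hLam hVo hVm).add_cylParaboloid hκ hν hV1 ha P
  have h2 := ((hsub.mono hVsub).supSol_neg hlam hLam hVo hVm).sub_cylParaboloid hκ hν hV1 ha P
  have hneg : (fun x => -u x + -cylParaboloid a ν P x) =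
      fun x => -(u x + cylParaboloid a ν P x) := funext fun x => by ring
  rw [hneg] at h2
  have hDa : 0 ≤ ((n + 1 : ℕ) : ℝ) * Lam / lam * (2 * a) := by positivity
  have key := SupSol.boundary_expansion hD hκ
    (c := (Lam * m₁ + Lam) / lam + ((n + 1 : ℕ) : ℝ) * Lam / lam * (2 * a) +
      Lam / lam * (2 * a + ‖P‖)) (by positivity) hν (R := 1 / 2) (by norm_num) hm₂0 h1
    (h2.mono le_rfl (by linarith) subset_rfl) hvC
    (fun x hx hx0 => by
      rw [hin] at hx0
      have := hbdry x (closedBall_subset_ball (by norm_num) hx) hx0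
      rw [hψ]
      linarith)
    (fun x hx hx0 => (abs_le.1 (hm₂ x ⟨hx, hx0⟩)).1)
  simp only [hin, hψ] at key
  have hr' : ∀ r : ℝ, 0 < r → min r (1 / 2) ∈ Ioo (0 : ℝ) 1 := fun r hr =>
    ⟨lt_min hr (by norm_num), (min_le_right _ _).trans_lt (by norm_num)⟩
  have hball : ∀ r : ℝ, ball (0 : Euc (n + 1)) (min r (1 / 2)) ⊆ ball 0 r := fun r =>
    ball_subset_ball (min_le_left _ _)
  refine key.imp (fun key pn => ?_) fun ⟨pn, key⟩ => ⟨pn, fun η hη => ?_⟩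
  · obtain ⟨r, hr, h⟩ := key pn
    exact ⟨_, hr' r hr, fun x hx hx0 => by linarith [h x (hball r hx) hx0]⟩
  · obtain ⟨r, hr, h, h'⟩ := key η hη
    exact ⟨_, hr' r hr, fun x hx hx0 => by linarith [h x (hball r hx) hx0],
      fun x hx hx0 => by linarith [h' x (hball r hx) hx0]⟩

end
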